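/- For every integer n ≥ 2, the set {π^n} ∪ {ζ_A(s_1, s_2) : s_1, s_2 ≥ 1, s_1 + s_2 = n, (q−1) ∤ s_2}, viewed inside L, is linearly independent over k. (This verifies Thakur's parity conjecture in depth two.) -/

import Mathlib

open Polynomial FunctionField

/-- The inclusion of `k = 𝔽_q(θ)` into its completion `k_∞ = 𝔽_q((1/θ))` at the
infinite place. -/
noncomputable def toKinfty (Fq : Type) [Field Fq] [DecidableEq (RatFunc Fq)] :
    RatFunc Fq →+* RatFunc.CompletionAtInfty Fq :=
  letI := RatFunc.inftyValued Fq
  UniformSpace.Completion.coeRingHom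

/-- The image of `θ` in `k_∞`. -/
noncomputable def thetaInfty (Fq : Type) [Field Fq] [DecidableEq (RatFunc Fq)] :
    RatFunc.CompletionAtInfty Fq :=
  toKinfty Fq (algebraMap (Polynomial Fq) (RatFunc Fq) X)

/-- The double zeta value `ζ_A(s₁, s₂) = Σ_{deg a₁ > deg a₂, both monic}
a₁^{-s₁} a₂^{-s₂} ∈ k_∞`. -/
noncomputable def doubleZeta (Fq : Type) [Field Fq] [Fintype Fq]
    [DecidableEq (RatFunc Fq)] (s₁ s₂ : ℕ) : RatFunc.CompletionAtInfty Fq :=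
  ∑' a : {g : Polynomial Fq × Polynomial Fq //
      g.1.Monic ∧ g.2.Monic ∧ g.2.degree < g.1.degree},
    toKinfty Fq
      (((algebraMap (Polynomial Fq) (RatFunc Fq) a.1.1) ^ s₁)⁻¹ *
        ((algebraMap (Polynomial Fq) (RatFunc Fq) a.1.2) ^ s₂)⁻¹)

/-- `ϖ = -θ^q ∏_{i=1}^∞ (1 - θ^{1-q^i})^{-(q-1)} ∈ k_∞`, which equals `π̃^{q-1}`
for a fundamental period `π̃` of the Carlitz module. -/
noncomputable def varpi (Fq : Type) [Field Fq] [Fintype Fq]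
    [DecidableEq (RatFunc Fq)] : RatFunc.CompletionAtInfty Fq :=
  -(thetaInfty Fq ^ Fintype.card Fq) *
    ∏' i : ℕ,
      ((1 - thetaInfty Fq ^ ((1 : ℤ) - (Fintype.card Fq : ℤ) ^ (i + 1)))⁻¹) ^
        (Fintype.card Fq - 1)

section Asymptotics

open WithZero

variable {k K : Type*} [Field k] [Field K]

/-- `IsBigO v q y e` says that `y N` grows at most like `θ ^ (e * q ^ N)`, up to a constant
factor, with respect to the valuation `v`. -/
def IsBigO (v : Valuation K ℤᵐ⁰) (q : ℕ) (y : ℕ → K) (e : ℤ) : Prop :=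
  ∃ C : ℤ, ∀ N, v (y N) ≤ exp (e * (q : ℤ) ^ N + C)

/-- A sequence is flat when it decays faster than every `θ ^ (-m * q ^ N)`. -/
def IsFlat (v : Valuation K ℤᵐ⁰) (q : ℕ) (y : ℕ → K) : Prop :=
  ∀ m : ℕ, IsBigO v q y (-m)

variable {v : Valuation K ℤᵐ⁰} {q : ℕ}

lemma exists_valuation_le (v : Valuation K ℤᵐ⁰) (x : K) : ∃ C : ℤ, v x ≤ exp C :=
  ⟨log (v x), le_exp_of_log_le le_rfl⟩

namespace IsBigO

variable {y z : ℕ → K} {e e' : ℤ}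

lemma mono (h : IsBigO v q y e) (hee : e ≤ e') : IsBigO v q y e' := by
  obtain ⟨C, hC⟩ := h
  refine ⟨C, fun N => (hC N).trans ?_⟩
  rw [exp_le_exp]
  have : (0 : ℤ) ≤ (q : ℤ) ^ N := by positivity
  nlinarith

lemma add (hy : IsBigO v q y e) (hz : IsBigO v q z e) : IsBigO v q (y + z) e := by
  obtain ⟨C, hC⟩ := hy
  obtain ⟨C', hC'⟩ := hz
  refine ⟨max C C', fun N => v.map_add_le ((hC N).trans ?_) ((hC' N).trans ?_)⟩ <;>
    rw [exp_le_exp] <;> simp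

lemma neg (hy : IsBigO v q y e) : IsBigO v q (-y) e := by
  obtain ⟨C, hC⟩ := hy
  exact ⟨C, fun N => by simpa [Valuation.map_neg] using hC N⟩

lemma sub (hy : IsBigO v q y e) (hz : IsBigO v q z e) : IsBigO v q (y - z) e := by
  rw [sub_eq_add_neg]
  exact hy.add hz.neg

lemma mul (hy : IsBigO v q y e) (hz : IsBigO v q z e') : IsBigO v q (y * z) (e + e') := by
  obtain ⟨C, hC⟩ := hy
  obtain ⟨C', hC'⟩ := hz
  refine ⟨C + C', fun N => ?_⟩
  have : (e + e') * (q : ℤ) ^ N + (C + C') = (e * (q : ℤ) ^ N + C) + (e' * (q : ℤ) ^ N + C') := by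
    ring
  rw [this, exp_add, Pi.mul_apply, map_mul]
  exact mul_le_mul' (hC N) (hC' N)

lemma zero : IsBigO v q (0 : ℕ → K) e := ⟨0, fun N => by simp⟩

lemma const (x : K) : IsBigO v q (fun _ => x) 0 := by
  obtain ⟨C, hC⟩ := exists_valuation_le v x
  exact ⟨C, fun N => by simpa using hC⟩

lemma sum {ι : Type*} (s : Finset ι) {f : ι → ℕ → K} (h : ∀ i ∈ s, IsBigO v q (f i) e) :
    IsBigO v q (∑ i ∈ s, f i) e := by
  classical
  induction s using Finset.induction_on with
  | empty => simpa using zero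
  | insert a s ha ih =>
    rw [Finset.sum_insert ha]
    exact (h a (by simp)).add (ih fun i hi => h i (by simp [hi]))

lemma of_eventually {N₀ : ℕ} {C : ℤ} (h : ∀ N, N₀ ≤ N → v (y N) ≤ exp (e * (q : ℤ) ^ N + C)) :
    IsBigO v q y e := by
  have key : ∀ M : ℕ, ∃ C' : ℤ, ∀ N < M, v (y N) ≤ exp (e * (q : ℤ) ^ N + C') := by
    intro M
    induction M with
    | zero => exact ⟨0, by simp⟩
    | succ M ih =>
      obtain ⟨C', hC'⟩ := ih
      obtain ⟨B, hB⟩ := exists_valuation_le v (y M)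
      refine ⟨max C' (B - e * (q : ℤ) ^ M), fun N hN => ?_⟩
      rcases Nat.lt_succ_iff_lt_or_eq.1 hN with h1 | rfl
      · exact (hC' N h1).trans (by rw [exp_le_exp]; simp)
      · refine hB.trans ?_
        rw [exp_le_exp]
        linarith [le_max_right C' (B - e * (q : ℤ) ^ N)]
  obtain ⟨C', hC'⟩ := key N₀
  refine ⟨max C C', fun N => ?_⟩
  rcases lt_or_ge N N₀ with h1 | h1
  · exact (hC' N h1).trans (by rw [exp_le_exp]; simp)
  · exact (h N h1).trans (by rw [exp_le_exp]; simp)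

lemma shift (h : IsBigO v q y e) : IsBigO v q (fun N => y (N + 1)) (e * q) := by
  obtain ⟨C, hC⟩ := h
  refine ⟨C, fun N => (hC (N + 1)).trans (by rw [exp_le_exp, pow_succ]; apply le_of_eq; ring)⟩

end IsBigO

namespace IsFlat

variable {y z : ℕ → K} {e : ℤ}

lemma isBigO (h : IsFlat v q y) (e : ℤ) : IsBigO v q y e :=
  (h (-e).toNat).mono (by have := Int.self_le_toNat (-e); linarith)

lemma sub (hy : IsFlat v q y) (hz : IsFlat v q z) : IsFlat v q (y - z) :=
  fun m => (hy m).sub (hz m)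

lemma mul_of_isBigO (hz : IsBigO v q z e) (hy : IsFlat v q y) : IsFlat v q (z * y) :=
  fun m => (hz.mul (hy.isBigO (-m - e))).mono (by linarith)

lemma shift (hq : 1 ≤ q) (h : IsFlat v q y) : IsFlat v q (fun N => y (N + 1)) := fun m => by
  refine (h m).shift.mono ?_
  have : (1 : ℤ) ≤ q := by exact_mod_cast hq
  nlinarith [Int.natCast_nonneg m]

end IsFlat

/-- A sequence has exact growth `(e, c)` when eventually `v (y N) = exp (e * q ^ N + c)`. -/
def HasGrowth (v : Valuation K ℤᵐ⁰) (q : ℕ) (y : ℕ → K) (e c : ℤ) : Prop :=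
  ∃ N₀, ∀ N, N₀ ≤ N → v (y N) = exp (e * (q : ℤ) ^ N + c)

lemma exists_forall_lt_of_lt (hq : 2 ≤ q) {e e' : ℤ} (h : e < e') (C C' : ℤ) :
    ∃ N₀ : ℕ, ∀ N, N₀ ≤ N → e * (q : ℤ) ^ N + C < e' * (q : ℤ) ^ N + C' := by
  refine ⟨(C - C').toNat, fun N hN => ?_⟩
  have h1 : (N : ℤ) < (q : ℤ) ^ N := by exact_mod_cast Nat.lt_pow_self (by omega)
  have h2 : C - C' ≤ N := (Int.self_le_toNat _).trans (by exact_mod_cast hN)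
  nlinarith

lemma HasGrowth.not_isFlat (hq : 2 ≤ q) {y : ℕ → K} {e c : ℤ} (h : HasGrowth v q y e c) :
    ¬ IsFlat v q y := fun hf => by
  obtain ⟨N₀, h⟩ := h
  obtain ⟨C, hC⟩ := hf.isBigO (e - 1)
  obtain ⟨N₁, h1⟩ := exists_forall_lt_of_lt hq (show e - 1 < e by linarith) C c
  have h2 := hC (max N₀ N₁)
  rw [h _ (le_max_left _ _), exp_le_exp] at h2
  exact absurd (h1 _ (le_max_right N₀ N₁)) (by linarith)

lemma HasGrowth.isBigO_of_mul {y z : ℕ → K} {e c e' : ℤ} (h : HasGrowth v q y e c)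
    (hyz : IsBigO v q (y * z) e') : IsBigO v q z (e' - e) := by
  obtain ⟨N₀, h⟩ := h
  obtain ⟨C, hC⟩ := hyz
  refine IsBigO.of_eventually (N₀ := N₀) (C := C - c) fun N hN => ?_
  have h1 := hC N
  rw [Pi.mul_apply, map_mul, h N hN] at h1
  have h2 : e' * (q : ℤ) ^ N + C = (e * (q : ℤ) ^ N + c) + ((e' - e) * (q : ℤ) ^ N + (C - c)) := by
    ring
  rw [h2, exp_add] at h1
  exact (mul_le_mul_iff_right₀ exp_pos).1 h1

lemma HasGrowth.isFlat_of_mul {y z : ℕ → K} {e c : ℤ} (h : HasGrowth v q y e c)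
    (hf : IsFlat v q (y * z)) : IsFlat v q z := fun m =>
  (h.isBigO_of_mul (hf.isBigO (-m + e))).mono (by linarith)

lemma HasGrowth.add_isBigO (hq : 2 ≤ q) {y z : ℕ → K} {e c e' : ℤ} (h : HasGrowth v q y e c)
    (hz : IsBigO v q z e') (hee : e' < e) : HasGrowth v q (y + z) e c := by
  obtain ⟨N₀, h⟩ := h
  obtain ⟨C, hC⟩ := hz
  obtain ⟨N₁, h1⟩ := exists_forall_lt_of_lt hq hee C c
  refine ⟨max N₀ N₁, fun N hN => ?_⟩
  have h2 := h N ((le_max_left _ _).trans hN)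
  rw [← h2, Pi.add_apply]
  apply Valuation.map_add_eq_of_lt_left
  rw [h2]
  exact (hC N).trans_lt (exp_lt_exp.2 (h1 N ((le_max_right _ _).trans hN)))

/-- Evaluation of a polynomial over `k` at the points `T ^ (q ^ N)`. -/
noncomputable def evalSeq (φ : k →+* K) (T : K) (q : ℕ) : k[X] →+* (ℕ → K) :=
  RingHom.pi fun N => eval₂RingHom φ (T ^ q ^ N)

variable {φ : k →+* K} {T : K}

lemma evalSeq_apply (p : k[X]) (N : ℕ) : evalSeq φ T q p N = p.eval₂ φ (T ^ q ^ N) := rfl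

@[simp] lemma evalSeq_C (a : k) (N : ℕ) : evalSeq φ T q (C a) N = φ a := by
  simp [evalSeq_apply]

@[simp] lemma evalSeq_X (N : ℕ) : evalSeq φ T q X N = T ^ q ^ N := by
  simp [evalSeq_apply]

lemma evalSeq_expand (p : k[X]) (N : ℕ) :
    evalSeq φ T q (expand k q p) N = evalSeq φ T q p (N + 1) := by
  rw [evalSeq_apply, evalSeq_apply, expand_eq_comp_X_pow, eval₂_comp, pow_succ, pow_mul]
  simp

lemma valuation_pow_pow (hT : v T = exp 1) (N r : ℕ) :
    v ((T ^ q ^ N) ^ r) = exp ((r : ℤ) * (q : ℤ) ^ N) := by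
  rw [← pow_mul, map_pow, hT, ← exp_nsmul]
  simp [mul_comm]

lemma isBigO_evalSeq (hT : v T = exp 1) (p : k[X]) {n : ℕ} (hn : p.natDegree ≤ n) :
    IsBigO v q (evalSeq φ T q p) n := by
  have h : evalSeq φ T q p =
      ∑ i ∈ Finset.range (n + 1), fun N => φ (p.coeff i) * (T ^ q ^ N) ^ i := by
    funext N
    rw [evalSeq_apply, eval₂_eq_sum_range' φ (Nat.lt_succ_of_le hn)]
    simp
  rw [h]
  refine IsBigO.sum _ fun i hi => ?_
  have h1 : IsBigO v q (fun N => (T ^ q ^ N) ^ i) (i : ℤ) :=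
    ⟨0, fun N => by rw [valuation_pow_pow hT, add_zero]⟩
  refine ((IsBigO.const (φ (p.coeff i))).mul h1).mono ?_
  have := Finset.mem_range.1 hi
  omega

lemma hasGrowth_evalSeq (hT : v T = exp 1) (hq : 2 ≤ q) {p : k[X]} (hp : p ≠ 0) :
    ∃ c, HasGrowth v q (evalSeq φ T q p) p.natDegree c := by
  obtain ⟨c, hc⟩ : ∃ c : ℤ, v (φ p.leadingCoeff) = exp c := by
    have : v (φ p.leadingCoeff) ≠ 0 := by simpa using hp
    exact ⟨log _, (exp_log this).symm⟩
  refine ⟨c, ?_⟩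
  have h1 : HasGrowth v q (evalSeq φ T q (C p.leadingCoeff * X ^ p.natDegree)) p.natDegree c := by
    refine ⟨0, fun N _ => ?_⟩
    rw [map_mul, map_pow, Pi.mul_apply, Pi.pow_apply, evalSeq_C, evalSeq_X, map_mul, hc,
      valuation_pow_pow hT, ← exp_add, add_comm]
  have h2 : evalSeq φ T q p = evalSeq φ T q (C p.leadingCoeff * X ^ p.natDegree) +
      evalSeq φ T q p.eraseLead := by
    rw [← map_add, add_comm, eraseLead_add_C_mul_X_pow]
  rw [h2]
  by_cases h3 : p.eraseLead = 0
  · simpa [h3] using h1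
  · have h4 : p.eraseLead.natDegree < p.natDegree := by
      rcases eraseLead_natDegree_lt_or_eraseLead_eq_zero p with h | h
      · exact h
      · exact absurd h h3
    exact h1.add_isBigO hq (isBigO_evalSeq hT p.eraseLead le_rfl) (by exact_mod_cast h4)

lemma eq_zero_of_isFlat_evalSeq (hT : v T = exp 1) (hq : 2 ≤ q) {p : k[X]}
    (h : IsFlat v q (evalSeq φ T q p)) :
    p = 0 := by
  by_contra hp
  obtain ⟨c, hc⟩ := hasGrowth_evalSeq (φ := φ) hT hq hp
  exact hc.not_isFlat hq h

/-- The ring of sequences with an asymptotic expansion in Laurent polynomials over `k`, evaluated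
at the points `T ^ (q ^ N)`. -/
def HasExpansion (φ : k →+* K) (v : Valuation K ℤᵐ⁰) (T : K) (q : ℕ) (y : ℕ → K) : Prop :=
  ∀ m : ℕ, ∃ (r : ℕ) (p : k[X]),
    IsBigO v q (y - evalSeq φ T q p / evalSeq φ T q (X ^ r)) (-m)

lemma isBigO_inv_X_pow (hT : v T = exp 1) (r : ℕ) : IsBigO v q (evalSeq φ T q (X ^ r))⁻¹ (-r) :=
  ⟨0, fun N => by
    rw [map_pow, Pi.inv_apply, Pi.pow_apply, evalSeq_X, map_inv₀, valuation_pow_pow hT, ← exp_neg,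
      add_zero, neg_mul]⟩

lemma evalSeq_X_pow_ne_zero (hT : v T = exp 1) (r N : ℕ) : evalSeq φ T q (X ^ r) N ≠ 0 := by
  have hT0 : T ≠ 0 := by
    rintro rfl
    rw [map_zero] at hT
    exact exp_ne_zero hT.symm
  simp [hT0]

namespace HasExpansion

variable {y z : ℕ → K}

lemma exists_isBigO (hT : v T = exp 1) (hy : HasExpansion φ v T q y) : ∃ n : ℕ, IsBigO v q y n := by
  obtain ⟨r, p, h⟩ := hy 0
  refine ⟨p.natDegree, ?_⟩
  have h1 : IsBigO v q (evalSeq φ T q p / evalSeq φ T q (X ^ r)) p.natDegree := by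
    rw [div_eq_mul_inv]
    exact ((isBigO_evalSeq hT p le_rfl).mul (isBigO_inv_X_pow hT r)).mono (by omega)
  simpa using (h.mono (e' := p.natDegree) (by simp)).add h1

lemma add (hT : v T = exp 1) (hy : HasExpansion φ v T q y) (hz : HasExpansion φ v T q z) :
    HasExpansion φ v T q (y + z) := fun m => by
  obtain ⟨r, p, h⟩ := hy m
  obtain ⟨r', p', h'⟩ := hz m
  refine ⟨r + r', p * X ^ r' + p' * X ^ r, ?_⟩
  convert h.add h' using 1
  funext N
  have h1 := evalSeq_X_pow_ne_zero (φ := φ) (q := q) hT r N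
  have h2 := evalSeq_X_pow_ne_zero (φ := φ) (q := q) hT r' N
  simp only [pow_add, map_add, map_mul, Pi.add_apply, Pi.sub_apply, Pi.div_apply, Pi.mul_apply]
  field_simp
  ring

lemma mul (hT : v T = exp 1) (hy : HasExpansion φ v T q y) (hz : HasExpansion φ v T q z) :
    HasExpansion φ v T q (y * z) := fun m => by
  obtain ⟨a, ha⟩ := hy.exists_isBigO hT
  obtain ⟨b, hb⟩ := hz.exists_isBigO hT
  obtain ⟨r, p, h⟩ := hy (m + b)
  obtain ⟨r', p', h'⟩ := hz (m + a)
  refine ⟨r + r', p * p', ?_⟩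
  have h1 : IsBigO v q (evalSeq φ T q p / evalSeq φ T q (X ^ r)) a := by
    simpa using ha.sub (h.mono (e' := a) (by push_cast; omega))
  have h2 := ((h.mul hb).mono (e' := -m) (by push_cast; omega)).add
    ((h1.mul h').mono (e' := -m) (by push_cast; omega))
  convert h2 using 1
  funext N
  simp only [pow_add, map_mul, Pi.add_apply, Pi.sub_apply, Pi.div_apply, Pi.mul_apply]
  rw [mul_div_mul_comm]
  ring

lemma evalSeq (p : k[X]) : HasExpansion φ v T q (evalSeq φ T q p) := fun m =>
  ⟨0, p, by simpa using IsBigO.zero⟩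

lemma mul_evalSeq (hT : v T = exp 1) (p : k[X]) (hy : HasExpansion φ v T q y) :
    HasExpansion φ v T q (_root_.evalSeq φ T q p * y) := (evalSeq p).mul hT hy

lemma neg (hT : v T = exp 1) (hy : HasExpansion φ v T q y) : HasExpansion φ v T q (-y) := by
  have h := hy.mul_evalSeq hT (C (-1))
  convert h using 1
  funext N
  simp

lemma sub (hT : v T = exp 1) (hy : HasExpansion φ v T q y) (hz : HasExpansion φ v T q z) :
    HasExpansion φ v T q (y - z) := by
  rw [sub_eq_add_neg]
  exact hy.add hT (hz.neg hT)

lemma sum (hT : v T = exp 1) {ι : Type*} (s : Finset ι) {f : ι → ℕ → K}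
    (h : ∀ i ∈ s, HasExpansion φ v T q (f i)) :
    HasExpansion φ v T q (∑ i ∈ s, f i) := by
  classical
  induction s using Finset.induction_on with
  | empty => simpa using HasExpansion.evalSeq (φ := φ) (v := v) (T := T) (q := q) (0 : k[X])
  | insert a s ha ih =>
    rw [Finset.sum_insert ha]
    exact (h a (by simp)).add hT (ih fun i hi => h i (by simp [hi]))

lemma pow (hT : v T = exp 1) (hy : HasExpansion φ v T q y) (n : ℕ) :
    HasExpansion φ v T q (y ^ n) := by
  induction n with
  | zero => simpa using HasExpansion.evalSeq (φ := φ) (v := v) (T := T) (q := q) (1 : k[X])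
  | succ n ih =>
    rw [pow_succ]
    exact ih.mul hT hy

lemma shift (hq : 1 ≤ q) (hy : HasExpansion φ v T q y) :
    HasExpansion φ v T q (fun N => y (N + 1)) := fun m => by
  obtain ⟨r, p, h⟩ := hy m
  refine ⟨q * r, expand k q p, ?_⟩
  have hq' : (1 : ℤ) ≤ q := by exact_mod_cast hq
  convert h.shift.mono (e' := -m) (by nlinarith [Int.natCast_nonneg m]) using 1
  funext N
  simp only [Pi.sub_apply, Pi.div_apply]
  rw [pow_mul, ← expand_X q, ← map_pow, evalSeq_expand, evalSeq_expand]

lemma of_approx (h : ∀ m : ℕ, ∃ z, HasExpansion φ v T q z ∧ IsBigO v q (y - z) (-m)) :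
    HasExpansion φ v T q y := fun m => by
  obtain ⟨z, hz, hyz⟩ := h m
  obtain ⟨r, p, hp⟩ := hz m
  refine ⟨r, p, ?_⟩
  convert hyz.add hp using 1
  ring

lemma isFlat_or_hasGrowth (hT : v T = exp 1) (hq : 2 ≤ q) (hy : HasExpansion φ v T q y) :
    IsFlat v q y ∨ ∃ e c, HasGrowth v q y e c := by
  by_contra! hcon
  obtain ⟨h1, h2⟩ := hcon
  rw [IsFlat] at h1
  push Not at h1
  obtain ⟨m, hm⟩ := h1
  obtain ⟨r, p, h⟩ := hy m
  have hp : p ≠ 0 := by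
    rintro rfl
    refine hm ?_
    convert h using 1
    funext N
    simp
  obtain ⟨c, hc⟩ := hasGrowth_evalSeq (φ := φ) hT hq hp
  have hg : HasGrowth v q (_root_.evalSeq φ T q p / _root_.evalSeq φ T q (X ^ r))
      (p.natDegree - r) c := by
    obtain ⟨N₀, hN⟩ := hc
    refine ⟨N₀, fun N h => ?_⟩
    rw [Pi.div_apply, map_div₀, hN N h, map_pow, Pi.pow_apply, evalSeq_X, valuation_pow_pow hT,
      ← exp_sub]
    congr 1
    ring
  rcases le_or_gt ((p.natDegree : ℤ) - r) (-m) with hle | hlt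
  · apply hm
    have h3 : IsBigO v q (_root_.evalSeq φ T q p / _root_.evalSeq φ T q (X ^ r)) (-m) := by
      rw [div_eq_mul_inv]
      exact ((isBigO_evalSeq hT p le_rfl).mul (isBigO_inv_X_pow hT r)).mono (by linarith)
    simpa using h.add h3
  · have h4 := hg.add_isBigO hq h hlt
    rw [add_sub_cancel] at h4
    exact h2 _ _ h4

end HasExpansion

lemma valuation_sub_pow (hT : v T = exp 1) (hq : 2 ≤ q) (N : ℕ) :
    v (T - T ^ q ^ (N + 1)) = exp ((q : ℤ) ^ (N + 1)) := by
  have h1 : v (T ^ q ^ (N + 1)) = exp ((q : ℤ) ^ (N + 1)) := by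
    simpa using valuation_pow_pow (q := q) hT (N + 1) 1
  have h2 : v T < v (T ^ q ^ (N + 1)) := by
    rw [h1, hT, exp_lt_exp]
    exact_mod_cast Nat.one_lt_pow (by omega) (by omega)
  rw [Valuation.map_sub_eq_of_lt_right v h2, h1]

lemma sub_pow_ne_zero (hT : v T = exp 1) (hq : 2 ≤ q) (N : ℕ) :
    T - T ^ q ^ (N + 1) ≠ 0 := fun h => by
  have := valuation_sub_pow hT hq N
  rw [h, map_zero] at this
  exact exp_ne_zero this.symm

lemma hasExpansion_inv_sub (hT : v T = exp 1) (hq : 2 ≤ q) {t : k} (ht : φ t = T) :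
    HasExpansion φ v T q (fun N => (T - T ^ q ^ (N + 1))⁻¹) := fun m => by
  refine ⟨q * m, -∑ i ∈ Finset.range m, (X ^ q) ^ i * (C t) ^ (m - 1 - i), m, fun N => ?_⟩
  have hT0 : T ≠ 0 := by
    rintro rfl
    rw [map_zero] at hT
    exact exp_ne_zero hT.symm
  have hD := sub_pow_ne_zero hT hq N
  have hv := valuation_sub_pow hT hq N
  have hval := valuation_pow_pow (q := q) hT (N + 1) m
  have hY : T ^ q ^ (N + 1) ≠ 0 := by simp [hT0]
  have hXq : evalSeq φ T q (X ^ q) N = T ^ q ^ (N + 1) := by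
    simp [pow_succ, pow_mul]
  have hgeom := geom_sum₂_mul (evalSeq φ T q (X ^ q) N) T m
  rw [hXq] at hgeom
  have hsum : evalSeq φ T q (-∑ i ∈ Finset.range m, (X ^ q) ^ i * (C t) ^ (m - 1 - i)) N =
      -∑ i ∈ Finset.range m, (T ^ q ^ (N + 1)) ^ i * T ^ (m - 1 - i) := by
    rw [map_neg, Pi.neg_apply, map_sum, Finset.sum_apply]
    congr 1
    refine Finset.sum_congr rfl fun i _ => ?_
    rw [map_mul, map_pow, Pi.mul_apply, Pi.pow_apply, hXq, map_pow, Pi.pow_apply, evalSeq_C, ht]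
  have hX : evalSeq φ T q (X ^ (q * m)) N = (T ^ q ^ (N + 1)) ^ m := by
    rw [pow_mul, map_pow, Pi.pow_apply, hXq]
  simp only [Pi.sub_apply, Pi.div_apply]
  rw [hsum, hX]
  set Y := T ^ q ^ (N + 1) with hYdef
  set G := ∑ i ∈ Finset.range m, Y ^ i * T ^ (m - 1 - i)
  have hkey : (T - Y)⁻¹ - -G / Y ^ m = T ^ m / (Y ^ m * (T - Y)) := by
    field_simp
    linear_combination -hgeom
  rw [hkey, map_div₀, map_mul, map_pow, hT, hval, hv, ← exp_nsmul, ← exp_add, ← exp_sub, exp_le_exp]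
  have h1 : (q : ℤ) ^ N ≤ (q : ℤ) ^ (N + 1) := by
    exact_mod_cast Nat.pow_le_pow_right (by omega) (by omega)
  have h2 : (0 : ℤ) ≤ (q : ℤ) ^ (N + 1) := by positivity
  simp only [nsmul_eq_mul]
  nlinarith [Int.natCast_nonneg m]

end Asymptotics

section Lifting

open WithZero

variable {k K : Type*} [Field k] [Field K] {v : Valuation K ℤᵐ⁰} {q : ℕ} {φ : k →+* K} {T : K}

lemma HasExpansion.exists_le {y : ℕ → K} (hT : v T = exp 1) (hy : HasExpansion φ v T q y)
    (m r₀ : ℕ) : ∃ (r : ℕ) (p : k[X]), r₀ ≤ r ∧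
      IsBigO v q (y - _root_.evalSeq φ T q p / _root_.evalSeq φ T q (X ^ r)) (-m) := by
  obtain ⟨r, p, h⟩ := hy m
  refine ⟨r + r₀, p * X ^ r₀, by omega, ?_⟩
  convert h using 2
  funext N
  have h1 := evalSeq_X_pow_ne_zero (φ := φ) (q := q) hT r₀ N
  rw [pow_add, map_mul, map_mul, Pi.div_apply, Pi.mul_apply, Pi.mul_apply, Pi.div_apply,
    mul_div_mul_right _ _ h1]

/-- Simultaneous Padé approximation of finitely many sequences with expansions by fractions with
a common denominator of large degree. -/
lemma exists_simultaneous_approx {ι : Type*} [Fintype ι] (hT : v T = exp 1) {y : ι → ℕ → K}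
    (hy : ∀ i, HasExpansion φ v T q (y i)) (m D : ℕ) :
    ∃ P : k[X], P ≠ 0 ∧ D ≤ P.natDegree ∧ ∃ Q : ι → k[X], ∀ i,
      IsBigO v q (evalSeq φ T q P * y i - evalSeq φ T q (Q i)) (-m) := by
  set B := Fintype.card ι * m
  choose r p hr hp using fun i => (hy i).exists_le hT (m + D + B) m
  let F : degreeLT k (B + 1) →ₗ[k] (ι × Fin m → k) :=
    LinearMap.pi fun il => (lcoeff k (r il.1 - m + il.2)).comp
      ((LinearMap.mulLeft k (X ^ D * p il.1)).comp (degreeLT k (B + 1)).subtype)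
  have hker : LinearMap.ker F ≠ ⊥ := by
    apply LinearMap.ker_ne_bot_of_finrank_lt
    rw [(degreeLTEquiv k (B + 1)).finrank_eq]
    simp [B]
  obtain ⟨⟨P', hP'⟩, hPk, hP0⟩ := Submodule.exists_mem_ne_zero_of_ne_bot hker
  have hP0 : P' ≠ 0 := fun h => hP0 (by simp [h])
  have hdeg : P'.natDegree ≤ B := by
    have := mem_degreeLT.1 hP'
    rw [← natDegree_lt_iff_degree_lt hP0] at this
    omega
  have hPk : ∀ i, ∀ l < m, (X ^ D * p i * P').coeff (r i - m + l) = 0 := fun i l hl =>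
    congrFun (LinearMap.mem_ker.1 hPk) (i, ⟨l, hl⟩)
  have hnd : (X ^ D * P').natDegree = D + P'.natDegree := by
    rw [natDegree_mul (by simp) hP0, natDegree_X_pow]
  refine ⟨X ^ D * P', mul_ne_zero (by simp) hP0, by omega,
    fun i => (X ^ D * p i * P') /ₘ X ^ r i, fun i => ?_⟩
  set W := X ^ D * p i * P' with hW
  have hdm : W %ₘ X ^ r i + X ^ r i * (W /ₘ X ^ r i) = W := modByMonic_add_div W _
  have hR : (W %ₘ X ^ r i).natDegree ≤ r i - m := by
    rw [natDegree_le_iff_coeff_eq_zero]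
    intro N hN
    rcases lt_or_ge N (r i) with h | h
    · have h1 := congrArg (fun p => p.coeff N) hdm
      simp only [coeff_add, coeff_X_pow_mul', not_le.2 h, if_false, add_zero] at h1
      rw [h1]
      have h2 := hPk i (N - (r i - m)) (by have := hr i; omega)
      rwa [show r i - m + (N - (r i - m)) = N by omega] at h2
    · apply coeff_eq_zero_of_degree_lt
      refine (degree_modByMonic_lt W (monic_X_pow (r i))).trans_le ?_
      rw [degree_X_pow]
      exact_mod_cast h
  have h1 : IsBigO v q (evalSeq φ T q (X ^ D * P') *
      (y i - evalSeq φ T q (p i) / evalSeq φ T q (X ^ r i))) (-m) := by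
    refine ((isBigO_evalSeq hT _ (n := D + B) (by omega)).mul (hp i)).mono ?_
    push_cast
    omega
  have h2 : IsBigO v q (evalSeq φ T q (W %ₘ X ^ r i) * (evalSeq φ T q (X ^ r i))⁻¹) (-m) := by
    refine ((isBigO_evalSeq hT _ hR).mul (isBigO_inv_X_pow hT (r i))).mono ?_
    have := hr i
    push_cast [this]
    omega
  convert h1.add h2 using 1
  funext N
  have h3 := congrFun (congrArg (evalSeq φ T q) hdm) N
  have h4 := evalSeq_X_pow_ne_zero (φ := φ) (q := q) hT (r i) N
  simp only [hW, map_add, map_mul, Pi.add_apply, Pi.mul_apply] at h3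
  simp only [map_mul, Pi.add_apply, Pi.mul_apply, Pi.sub_apply, Pi.div_apply, Pi.inv_apply]
  field_simp
  linear_combination -h3

/-- A sequence in `k` has bounded denominators over `A` when a single nonzero element of `A`
clears all of them. -/
def HasBoundedDenom (A : Subring k) (x : ℕ → k) : Prop :=
  ∃ δ ∈ A, δ ≠ 0 ∧ ∀ N, δ * x N ∈ A

namespace HasBoundedDenom

variable {A : Subring k} {x y : ℕ → k}

lemma add (hx : HasBoundedDenom A x) (hy : HasBoundedDenom A y) : HasBoundedDenom A (x + y) := by
  obtain ⟨δ, hδ, h0, h⟩ := hx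
  obtain ⟨ε, hε, h0', h'⟩ := hy
  refine ⟨δ * ε, A.mul_mem hδ hε, mul_ne_zero h0 h0', fun N => ?_⟩
  have := A.add_mem (A.mul_mem hε (h N)) (A.mul_mem hδ (h' N))
  convert this using 1
  rw [Pi.add_apply]
  ring

lemma mul (hx : HasBoundedDenom A x) (hy : HasBoundedDenom A y) : HasBoundedDenom A (x * y) := by
  obtain ⟨δ, hδ, h0, h⟩ := hx
  obtain ⟨ε, hε, h0', h'⟩ := hy
  refine ⟨δ * ε, A.mul_mem hδ hε, mul_ne_zero h0 h0', fun N => ?_⟩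
  have := A.mul_mem (h N) (h' N)
  convert this using 1
  rw [Pi.mul_apply]
  ring

lemma of_mem (h : ∀ N, x N ∈ A) : HasBoundedDenom A x :=
  ⟨1, A.one_mem, one_ne_zero, fun N => by simpa using h N⟩

lemma const (hA : ∀ x : k, ∃ δ ∈ A, δ ≠ 0 ∧ δ * x ∈ A) (a : k) :
    HasBoundedDenom A fun _ => a := by
  obtain ⟨δ, hδ, h0, h⟩ := hA a
  exact ⟨δ, hδ, h0, fun _ => h⟩

lemma sum {ι : Type*} (s : Finset ι) {f : ι → ℕ → k} (h : ∀ i ∈ s, HasBoundedDenom A (f i)) :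
    HasBoundedDenom A (∑ i ∈ s, f i) := by
  classical
  induction s using Finset.induction_on with
  | empty => exact of_mem fun N => by simp
  | insert a s ha ih =>
    rw [Finset.sum_insert ha]
    exact (h a (by simp)).add (ih fun i hi => h i (by simp [hi]))

lemma eval (hA : ∀ x : k, ∃ δ ∈ A, δ ≠ 0 ∧ δ * x ∈ A) (p : k[X]) (hx : ∀ N, x N ∈ A) :
    HasBoundedDenom A fun N => p.eval (x N) := by
  have h : (fun N => p.eval (x N)) =
      ∑ i ∈ Finset.range (p.natDegree + 1), (fun _ => p.coeff i) * fun N => x N ^ i := by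
    funext N
    rw [eval_eq_sum_range]
    simp
  rw [h]
  exact sum _ fun i _ => (const hA _).mul (of_mem fun N => A.pow_mem (hx N) i)

lemma eventually_eq_zero (hq : 2 ≤ q) (hA : ∀ x ∈ A, v (φ x) < 1 → x = 0)
    (hx : HasBoundedDenom A x) (hO : IsBigO v q (fun N => φ (x N)) (-1)) :
    ∀ᶠ N in Filter.atTop, x N = 0 := by
  obtain ⟨δ, hδ, h0, h⟩ := hx
  obtain ⟨C, hC⟩ := ((IsBigO.const (φ δ)).mul hO)
  obtain ⟨N₀, hN₀⟩ := exists_forall_lt_of_lt hq (show (-1 : ℤ) < 0 by norm_num) C 0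
  refine Filter.eventually_atTop.2 ⟨N₀, fun N hN => ?_⟩
  have h1 : δ * x N = 0 := by
    refine hA _ (h N) ?_
    rw [map_mul]
    refine (hC N).trans_lt ?_
    rw [← exp_zero, exp_lt_exp]
    simpa using hN₀ N hN
  exact (mul_eq_zero.1 h1).resolve_left h0

end HasBoundedDenom

lemma evalSeq_eq_map_eval {t : k} (ht : φ t = T) (p : k[X]) (N : ℕ) :
    evalSeq φ T q p N = φ (p.eval (t ^ q ^ N)) := by
  rw [evalSeq_apply, ← ht, ← map_pow, eval₂_at_apply]

/-- A vector of a finite free module over a PID which has no nonzero multiple in a submodule is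
detected by a linear functional vanishing on that submodule. -/
lemma exists_linearMap_of_forall_smul_notMem {R M : Type*} [CommRing R] [IsDomain R]
    [IsPrincipalIdealRing R] [AddCommGroup M] [Module R M] [Module.Finite R M]
    (S : Submodule R M) (e : M) (h : ∀ Q : R, Q ≠ 0 → Q • e ∉ S) :
    ∃ u : M →ₗ[R] R, u e ≠ 0 ∧ ∀ x ∈ S, u x = 0 := by
  let tors := Submodule.torsion R (M ⧸ S)
  have hfree : Module.Free R ((M ⧸ S) ⧸ tors) := inferInstance
  have hne : (tors.mkQ (S.mkQ e)) ≠ 0 := by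
    intro h0
    rw [Submodule.mkQ_apply, Submodule.Quotient.mk_eq_zero, Submodule.mem_torsion_iff] at h0
    obtain ⟨Q, hQ⟩ := h0
    refine h Q (nonZeroDivisors.coe_ne_zero Q) ?_
    rw [← Submodule.Quotient.mk_eq_zero, Submodule.Quotient.mk_smul]
    exact hQ
  have h1 := mt (Module.forall_dual_apply_eq_zero_iff R (tors.mkQ (S.mkQ e))).1 hne
  push Not at h1
  obtain ⟨f, hf⟩ := h1
  refine ⟨f.comp (tors.mkQ.comp S.mkQ), hf, fun x hx => ?_⟩
  have : S.mkQ x = 0 := by simpa using hx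
  simp [this]

/-- A family of linear relations over `k` among the values of sequences with expansions, with
controlled denominators and sizes, lifts to a functional relation over `k[X]`. -/
lemma exists_relation_isFlat {ι : Type*} [Fintype ι] {A : Subring k} {t : k} (ht : φ t = T)
    (htA : t ∈ A) (hA : ∀ x : k, ∃ δ ∈ A, δ ≠ 0 ∧ δ * x ∈ A)
    (hAv : ∀ x ∈ A, v (φ x) < 1 → x = 0)
    (hT : v T = exp 1) (hq : 2 ≤ q) {y : ι → ℕ → K} (hy : ∀ i, HasExpansion φ v T q (y i))
    {a : ℕ → k} {b : ι → ℕ → k} (ha : HasBoundedDenom A a) (hb : ∀ i, HasBoundedDenom A (b i))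
    {κ : ℕ} (hbO : ∀ i, IsBigO v q (fun N => φ (b i N)) κ) {i₀ : ι} (hi₀ : ∀ N, b i₀ N = 1)
    (hrel : ∀ N, φ (a N) + ∑ i, φ (b i N) * y i N = 0) :
    ∃ (u₀ : k[X]) (u : ι → k[X]), (u₀ ≠ 0 ∨ u ≠ 0) ∧
      IsFlat v q (evalSeq φ T q u₀ + ∑ i, evalSeq φ T q (u i) * y i) := by
  classical
  let b' : Option ι → ℕ → k := fun o => o.elim a b
  have hb' : ∀ o, HasBoundedDenom A (b' o) := fun o => by cases o <;> simp [b', ha, hb]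
  let 𝓜 : Set (Option ι → k[X]) := {x | ∀ i, IsBigO v q
    (evalSeq φ T q (x none) * y i - evalSeq φ T q (x (some i))) (-(κ + 1 : ℕ))}
  let S := Submodule.span k[X] 𝓜
  have hS : ∀ x ∈ S, ∀ᶠ N in Filter.atTop, ∑ o, b' o N * (x o).eval (t ^ q ^ N) = 0 := by
    intro x hx
    induction hx using Submodule.span_induction with
    | mem x hx =>
      refine HasBoundedDenom.eventually_eq_zero (φ := φ) (v := v) (A := A) hq hAv ?_ ?_
      · convert HasBoundedDenom.sum (A := A) Finset.univ
          (f := fun o => b' o * fun N => (x o).eval (t ^ q ^ N)) fun o _ =>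
            (hb' o).mul (HasBoundedDenom.eval hA _ fun N => A.pow_mem htA _) using 1
        funext N
        simp
      · have h1 : IsBigO v q (∑ i, (fun N => φ (b i N)) *
            -(evalSeq φ T q (x none) * y i - evalSeq φ T q (x (some i)))) (-1) :=
          IsBigO.sum _ fun i _ => ((hbO i).mul (hx i).neg).mono (by push_cast; omega)
        convert h1 using 1
        funext N
        have h2 := hrel N
        simp only [Fintype.sum_option, b', Option.elim, map_add, map_sum, map_mul,
          ← evalSeq_eq_map_eval ht, Finset.sum_apply, Pi.mul_apply, Pi.neg_apply, Pi.sub_apply]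
        have h3 : ∀ i, φ (b i N) * -(evalSeq φ T q (x none) N * y i N -
            evalSeq φ T q (x (some i)) N) = φ (b i N) * evalSeq φ T q (x (some i)) N -
            evalSeq φ T q (x none) N * (φ (b i N) * y i N) := fun i => by ring
        simp only [h3, Finset.sum_sub_distrib, ← Finset.mul_sum]
        linear_combination evalSeq φ T q (x none) N * h2
    | zero => simp
    | add x z _ _ hx hz =>
      filter_upwards [hx, hz] with N h1 h2
      simp only [Pi.add_apply, eval_add, mul_add, Finset.sum_add_distrib, h1, h2, add_zero]
    | smul c x _ hx =>
      filter_upwards [hx] with N h1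
      simp only [Pi.smul_apply, smul_eq_mul, eval_mul, mul_left_comm (b' _ N), ← Finset.mul_sum,
        h1, mul_zero]
  obtain ⟨u, hue, hu⟩ := exists_linearMap_of_forall_smul_notMem S (Pi.single (some i₀) 1) (by
    intro Q hQ hmem
    obtain ⟨c, N₀, hc⟩ := hasGrowth_evalSeq (φ := φ) hT hq hQ
    obtain ⟨N₁, hN₁⟩ := Filter.eventually_atTop.1 (hS _ hmem)
    have h1 := hN₁ (max N₀ N₁) (le_max_right _ _)
    have h2 := hc (max N₀ N₁) (le_max_left _ _)
    rw [Finset.sum_eq_single (some i₀) (fun o _ ho => by simp [Pi.single_eq_of_ne ho])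
      (by simp)] at h1
    simp only [b', Option.elim, hi₀, Pi.smul_apply, Pi.single_eq_same, smul_eq_mul, mul_one,
      one_mul] at h1
    rw [evalSeq_eq_map_eval ht, h1, map_zero, map_zero] at h2
    exact exp_ne_zero h2.symm)
  let w : Option ι → k[X] := fun o => u (Pi.single o 1)
  have huw : ∀ x, u x = ∑ o, w o * x o := fun x => by
    conv_lhs => rw [← Finset.univ_sum_single x]
    rw [map_sum]
    refine Finset.sum_congr rfl fun o _ => ?_
    rw [mul_comm, ← smul_eq_mul, ← map_smul, ← Pi.single_smul, smul_eq_mul, mul_one]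
  refine ⟨w none, fun i => w (some i), Or.inr fun h => hue (congrFun h i₀), fun m => ?_⟩
  obtain ⟨d, hd⟩ : ∃ d, ∀ i, (w (some i)).natDegree ≤ d :=
    ⟨Finset.univ.sup fun i => (w (some i)).natDegree, fun i =>
      Finset.le_sup (f := fun i => (w (some i)).natDegree) (Finset.mem_univ i)⟩
  obtain ⟨P, hP0, hPd, Q, hQ⟩ := exists_simultaneous_approx hT hy (κ + 1) (m + d)
  have hmem : (fun o : Option ι => o.elim P Q) ∈ S := Submodule.subset_span fun i => hQ i
  have h0 := hu _ hmem
  rw [huw, Fintype.sum_option] at h0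
  simp only [Option.elim] at h0
  have h1 : IsBigO v q (∑ i, evalSeq φ T q (w (some i)) *
      (evalSeq φ T q P * y i - evalSeq φ T q (Q i))) d :=
    IsBigO.sum _ fun i _ => ((isBigO_evalSeq hT _ (hd i)).mul (hQ i)).mono (by push_cast; omega)
  have h2 : evalSeq φ T q P * (evalSeq φ T q (w none) + ∑ i, evalSeq φ T q (w (some i)) * y i) =
      ∑ i, evalSeq φ T q (w (some i)) * (evalSeq φ T q P * y i - evalSeq φ T q (Q i)) := by
    have h3 := congrArg (evalSeq φ T q) h0
    simp only [map_add, map_sum, map_mul, map_zero] at h3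
    simp only [mul_sub, Finset.sum_sub_distrib, mul_add, Finset.mul_sum,
      mul_left_comm (evalSeq φ T q P)]
    linear_combination h3
  obtain ⟨c, hc⟩ := hasGrowth_evalSeq (φ := φ) hT hq hP0
  refine (hc.isBigO_of_mul (h2 ▸ h1)).mono ?_
  push_cast at *
  omega

end Lifting

section Independence

open WithZero

variable {k K : Type*} [Field k] [Field K] {v : Valuation K ℤᵐ⁰} {q : ℕ} {φ : k →+* K} {T : K}

lemma exists_isCoprime_mul {A B : k[X]} (hB : B ≠ 0) :
    ∃ g a b : k[X], g ≠ 0 ∧ A = g * a ∧ B = g * b ∧ IsCoprime a b := by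
  classical
  have hg : EuclideanDomain.gcd A B ≠ 0 := fun h => hB (EuclideanDomain.gcd_eq_zero_iff.1 h).2
  obtain ⟨a, ha⟩ := EuclideanDomain.gcd_dvd_left A B
  obtain ⟨b, hb⟩ := EuclideanDomain.gcd_dvd_right A B
  have hab := EuclideanDomain.gcd_eq_gcd_ab A B
  generalize EuclideanDomain.gcd A B = g at hg ha hb hab
  refine ⟨g, a, b, hg, ha, hb, EuclideanDomain.gcdA A B, EuclideanDomain.gcdB A B,
    mul_left_cancel₀ hg ?_⟩
  conv_rhs => rw [mul_one, hab]
  linear_combination -EuclideanDomain.gcdA A B * ha - EuclideanDomain.gcdB A B * hb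

lemma exists_eq_C_of_expand_dvd (hq : 2 ≤ q) {a : k[X]} (ha : a ≠ 0) (h : expand k q a ∣ a) :
    ∃ c, c ≠ 0 ∧ a = C c := by
  have h1 := natDegree_le_of_dvd h ha
  rw [natDegree_expand] at h1
  have h2 : a.natDegree = 0 := by nlinarith
  obtain ⟨c, rfl⟩ := natDegree_eq_zero.1 h2
  exact ⟨c, by rintro rfl; simp at ha, rfl⟩

/-- The polynomial `θ - X ^ q`, whose value at `θ ^ (q ^ N)` is `θ - θ ^ (q ^ (N + 1))`. -/
noncomputable def frobDiff (t : k) (q : ℕ) : k[X] := C t - X ^ q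

lemma natDegree_frobDiff (t : k) (q : ℕ) : (frobDiff t q).natDegree = q := by
  rw [frobDiff, natDegree_sub, natDegree_X_pow_sub_C]

lemma frobDiff_ne_zero (t : k) (hq : 1 ≤ q) : frobDiff t q ≠ 0 := fun h => by
  have := natDegree_frobDiff t q
  rw [h, natDegree_zero] at this
  omega

lemma evalSeq_frobDiff {t : k} (ht : φ t = T) (N : ℕ) :
    evalSeq φ T q (frobDiff t q) N = T - T ^ q ^ (N + 1) := by
  rw [frobDiff, map_sub, map_pow, Pi.sub_apply, Pi.pow_apply, evalSeq_C, evalSeq_X, ht, pow_succ,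
    pow_mul]

lemma eval_eq_zero_of_frobDiff_dvd {t : k} (hq : 1 ≤ q) {b : k[X]}
    (h : frobDiff t q ∣ expand k q b) : b.eval t = 0 := by
  have h1 : expand k q b = frobDiff t q * -expand k q (b /ₘ (X - C t)) + C (b.eval t) := by
    conv_lhs => rw [← modByMonic_add_div b (X - C t), modByMonic_X_sub_C_eq_C_eval]
    simp [frobDiff]
    ring
  have h2 : frobDiff t q ∣ C (b.eval t) := (dvd_add_right (dvd_mul_right _ _)).1 (h1 ▸ h)
  by_contra h3
  have h4 := natDegree_le_of_dvd h2 (C_ne_zero.2 h3)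
  rw [natDegree_frobDiff t q, natDegree_C] at h4
  omega

lemma ne_expand_mul_of_pos (hT : v T = exp 1) {t : k} (ht : φ t = T) (hq : 2 ≤ q) {A B : k[X]}
    (hA : A ≠ 0) (hB : B ≠ 0) {m : ℕ} (hm : m ≠ 0) :
    expand k q A * frobDiff t q ^ m * B ≠ A * expand k q B := by
  intro h
  obtain ⟨g, a, b, hg, rfl, rfl, hab⟩ := exists_isCoprime_mul (A := A) hB
  have hg' : expand k q g ≠ 0 := (expand_ne_zero (by omega)).2 hg
  have h1 : expand k q a * frobDiff t q ^ m * b = a * expand k q b := by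
    refine mul_left_cancel₀ (mul_ne_zero hg hg') ?_
    rw [map_mul, map_mul] at h
    linear_combination h
  have hab' : IsCoprime (expand k q a) (expand k q b) := hab.map (expand k q).toRingHom
  have h2 : expand k q a ∣ a := by
    refine hab'.dvd_of_dvd_mul_right ?_
    rw [← h1, mul_assoc]
    exact dvd_mul_right _ _
  obtain ⟨c, hc, rfl⟩ := exists_eq_C_of_expand_dvd hq (right_ne_zero_of_mul hA) h2
  have h3 : frobDiff t q ^ m * b = expand k q b := by
    rw [expand_C, mul_assoc] at h1
    exact mul_left_cancel₀ (C_ne_zero.2 hc) h1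
  have h4 : b.eval t = 0 := by
    refine eval_eq_zero_of_frobDiff_dvd (q := q) (by omega) ((dvd_pow_self _ hm).trans ?_)
    rw [← h3]
    exact dvd_mul_right _ _
  have h5 : ∀ N, evalSeq φ T q b N = 0 := by
    intro N
    induction N with
    | zero => simp [evalSeq_eq_map_eval ht, h4]
    | succ N ih => rw [← evalSeq_expand, ← h3, map_mul, Pi.mul_apply, ih, mul_zero]
  refine right_ne_zero_of_mul hB (eq_zero_of_isFlat_evalSeq (φ := φ) hT hq (p := b) ?_)
  rw [show evalSeq φ T q b = 0 from funext h5]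
  exact fun m => IsBigO.zero

lemma eq_zero_of_isFlat_single (hT : v T = exp 1) {t : k} (ht : φ t = T) (hq : 2 ≤ q)
    {s : ℕ} (hs : s ≠ 0) {f : ℕ → K} {α : k[X]} (hf0 : f 0 ≠ 0)
    (hf : ∀ N, f (N + 1) = evalSeq φ T q (frobDiff t q ^ s) N * (f N - evalSeq φ T q α N))
    {A B : k[X]} (h : IsFlat v q (evalSeq φ T q B * f - evalSeq φ T q A)) : B = 0 := by
  by_contra hB
  have hBY : IsFlat v q (evalSeq φ T q (expand k q B) * (fun N => f (N + 1)) -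
      evalSeq φ T q (expand k q A)) := by
    convert h.shift (by omega) using 1
    funext N
    simp [evalSeq_expand]
  have hAB : expand k q A * B = frobDiff t q ^ s * expand k q B * (A - α * B) := by
    rw [← sub_eq_zero]
    refine eq_zero_of_isFlat_evalSeq (φ := φ) hT hq ?_
    have h1 := (IsFlat.mul_of_isBigO
      (isBigO_evalSeq hT (φ := φ) (q := q) (frobDiff t q ^ s * expand k q B) le_rfl) h).sub
      (IsFlat.mul_of_isBigO (isBigO_evalSeq hT (φ := φ) (q := q) B le_rfl) hBY)
    convert h1 using 1
    funext N
    simp only [map_sub, map_mul, Pi.sub_apply, Pi.mul_apply, hf N]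
    ring
  obtain ⟨g, a, b, hg, rfl, rfl, hab⟩ := exists_isCoprime_mul (A := A) hB
  have hg' : expand k q g ≠ 0 := (expand_ne_zero (by omega)).2 hg
  have h1 : expand k q a * b = frobDiff t q ^ s * expand k q b * (a - α * b) := by
    refine mul_left_cancel₀ (mul_ne_zero hg hg') ?_
    rw [map_mul, map_mul] at hAB
    linear_combination hAB
  have hab' : IsCoprime (expand k q b) (expand k q a) := hab.symm.map (expand k q).toRingHom
  have h2 : expand k q b ∣ b := by
    refine hab'.dvd_of_dvd_mul_left ?_
    rw [h1, mul_right_comm]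
    exact dvd_mul_left _ _
  obtain ⟨c, hc, rfl⟩ := exists_eq_C_of_expand_dvd hq (right_ne_zero_of_mul hB) h2
  have h3 : expand k q a = frobDiff t q ^ s * (a - α * C c) := by
    rw [expand_C] at h1
    refine mul_right_cancel₀ (C_ne_zero.2 hc) ?_
    linear_combination h1
  have h4 : a.eval t = 0 := by
    refine eval_eq_zero_of_frobDiff_dvd (q := q) (by omega) ((dvd_pow_self _ hs).trans ?_)
    rw [h3]
    exact dvd_mul_right _ _
  have hflat : IsFlat v q (evalSeq φ T q (C c) * f - evalSeq φ T q a) := by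
    obtain ⟨c', hc'⟩ := hasGrowth_evalSeq (φ := φ) hT hq hg
    refine hc'.isFlat_of_mul ?_
    convert h using 1
    rw [map_mul, map_mul]
    ring
  have hstep : ∀ N, (evalSeq φ T q (C c) * f - evalSeq φ T q a) (N + 1) =
      (T - T ^ q ^ (N + 1)) ^ s * (evalSeq φ T q (C c) * f - evalSeq φ T q a) N := by
    intro N
    have h5 := congrFun (congrArg (evalSeq φ T q) h3) N
    rw [evalSeq_expand] at h5
    simp only [Pi.sub_apply, Pi.mul_apply, hf N, h5, map_mul, map_pow, map_sub, Pi.pow_apply,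
      evalSeq_frobDiff ht, evalSeq_C]
    ring
  have hlow : ∀ N, v (φ c * f 0) ≤ v ((evalSeq φ T q (C c) * f - evalSeq φ T q a) N) := by
    intro N
    induction N with
    | zero => simp [evalSeq_eq_map_eval ht, h4]
    | succ N ih =>
      rw [hstep, v.map_mul ((T - T ^ q ^ (N + 1)) ^ s), v.map_pow, valuation_sub_pow hT hq,
        ← exp_nsmul]
      refine ih.trans (le_mul_of_one_le_left' ?_)
      rw [← exp_zero, exp_le_exp]
      positivity
  obtain ⟨c', hc'⟩ : ∃ c' : ℤ, v (φ c * f 0) = exp c' :=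
    ⟨log _, (exp_log (by simp [hc, hf0])).symm⟩
  obtain ⟨C', hC'⟩ := hflat.isBigO (-1)
  obtain ⟨N₀, hN₀⟩ := exists_forall_lt_of_lt hq (show (-1 : ℤ) < 0 by norm_num) C' c'
  have h6 := (hlow N₀).trans (hC' N₀)
  rw [hc', exp_le_exp] at h6
  have := hN₀ N₀ le_rfl
  omega

/-- Sequences satisfying `f (N + 1) = D ^ w * (f N - α)` for distinct positive weights `w` are
linearly independent over `k[X]`, together with `1`, modulo flat sequences. -/
lemma eq_zero_of_isFlat_sum {ι : Type*} (hT : v T = exp 1) {t : k} (ht : φ t = T) (hq : 2 ≤ q)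
    (S : Finset ι) (w : ι → ℕ) (hw : ∀ i ∈ S, w i ≠ 0) (hinj : Set.InjOn w S)
    {f : ι → ℕ → K} {α : ι → k[X]} (hf0 : ∀ i ∈ S, f i 0 ≠ 0)
    (hf : ∀ i ∈ S, ∀ N, f i (N + 1) =
      evalSeq φ T q (frobDiff t q ^ w i) N * (f i N - evalSeq φ T q (α i) N))
    {u₀ : k[X]} {u : ι → k[X]}
    (h : IsFlat v q (evalSeq φ T q u₀ + ∑ i ∈ S, evalSeq φ T q (u i) * f i)) :
    u₀ = 0 ∧ ∀ i ∈ S, u i = 0 := by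
  classical
  induction S using Finset.strongInduction generalizing u₀ u with
  | H S ih =>
  have herase : ∀ i ∈ S, ∀ (u₀ : k[X]) (u : ι → k[X]),
      IsFlat v q (evalSeq φ T q u₀ + ∑ j ∈ S.erase i, evalSeq φ T q (u j) * f j) →
      u₀ = 0 ∧ ∀ j ∈ S.erase i, u j = 0 := fun i hi u₀ u h =>
    ih (S.erase i) (Finset.erase_ssubset hi) (fun j hj => hw j (Finset.mem_of_mem_erase hj))
      (hinj.mono (by simp)) (fun j hj => hf0 j (Finset.mem_of_mem_erase hj))
      (fun j hj => hf j (Finset.mem_of_mem_erase hj)) h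
  have hzero : ∀ i ∈ S, u i = 0 → u₀ = 0 ∧ ∀ i ∈ S, u i = 0 := by
    intro i hi hui
    rw [← Finset.add_sum_erase S _ hi, hui, map_zero, zero_mul, zero_add] at h
    obtain ⟨h0, h1⟩ := herase i hi u₀ u h
    refine ⟨h0, fun j hj => ?_⟩
    by_cases hji : j = i
    · rw [hji, hui]
    · exact h1 j (Finset.mem_erase.2 ⟨hji, hj⟩)
  rcases S.eq_empty_or_nonempty with rfl | ⟨i, hi⟩
  · refine ⟨eq_zero_of_isFlat_evalSeq (φ := φ) hT hq (by simpa using h), by simp⟩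
  have hshift : IsFlat v q (evalSeq φ T q (expand k q u₀) + ∑ j ∈ S,
      evalSeq φ T q (expand k q (u j)) * (evalSeq φ T q (frobDiff t q ^ w j) *
        (f j - evalSeq φ T q (α j)))) := by
    convert h.shift (by omega) using 1
    funext N
    simp only [Pi.add_apply, Finset.sum_apply, Pi.mul_apply, evalSeq_expand, Pi.sub_apply]
    congr 1
    exact Finset.sum_congr rfl fun j hj => by rw [hf j hj]
  have hcomb : ∀ j ∈ S.erase i, u i * (expand k q (u j) * frobDiff t q ^ w j) -
      expand k q (u i) * frobDiff t q ^ w i * u j = 0 := by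
    refine (herase i hi (u i * (expand k q u₀ -
      ∑ j ∈ S, expand k q (u j) * frobDiff t q ^ w j * α j) -
      expand k q (u i) * frobDiff t q ^ w i * u₀) _ ?_).2
    have h1 := (IsFlat.mul_of_isBigO (isBigO_evalSeq hT (φ := φ) (q := q) (u i) le_rfl)
      hshift).sub (IsFlat.mul_of_isBigO (isBigO_evalSeq hT (φ := φ) (q := q)
        (expand k q (u i) * frobDiff t q ^ w i) le_rfl) h)
    convert h1 using 1
    rw [← add_right_inj, Finset.sum_erase _ (by rw [sub_eq_zero.2 (by ring), map_zero, zero_mul])]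
    · simp only [map_sub, map_mul, map_sum, mul_add, mul_sub, sub_mul, Finset.sum_sub_distrib,
        Finset.mul_sum, mul_assoc]
      ring
  by_cases hi0 : u i = 0
  · exact hzero i hi hi0
  rcases (S.erase i).eq_empty_or_nonempty with hS | ⟨j, hj⟩
  · exfalso
    rw [← Finset.add_sum_erase S _ hi, hS, Finset.sum_empty, add_zero] at h
    refine hi0 (eq_zero_of_isFlat_single hT ht hq (hw i hi) (hf0 i hi) (hf i hi) (A := -u₀) ?_)
    rwa [map_neg, sub_neg_eq_add, add_comm]
  · obtain ⟨hji, hjS⟩ := Finset.mem_erase.1 hj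
    by_cases hj0 : u j = 0
    · exact hzero j hjS hj0
    exfalso
    have h1 := hcomb j hj
    have hD := frobDiff_ne_zero t (q := q) (by omega)
    rcases lt_or_gt_of_ne (hinj.ne hi hjS (Ne.symm hji)) with hlt | hlt
    · refine ne_expand_mul_of_pos hT ht hq hj0 hi0 (m := w j - w i) (by omega)
        (mul_left_cancel₀ (pow_ne_zero (w i) hD) ?_)
      have : frobDiff t q ^ w j = frobDiff t q ^ w i * frobDiff t q ^ (w j - w i) := by
        rw [← pow_add]
        congr 1
        omega
      rw [this] at h1
      linear_combination h1
    · refine ne_expand_mul_of_pos hT ht hq hi0 hj0 (m := w i - w j) (by omega)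
        (mul_left_cancel₀ (pow_ne_zero (w j) hD) ?_)
      have : frobDiff t q ^ w i = frobDiff t q ^ w j * frobDiff t q ^ (w i - w j) := by
        rw [← pow_add]
        congr 1
        omega
      rw [this] at h1
      linear_combination -h1

end Independence

section Independence

open WithZero

variable {k K : Type*} [Field k] [Field K] {v : Valuation K ℤᵐ⁰} {q : ℕ} {φ : k →+* K} {T : K}

lemma HasGrowth.mul {y z : ℕ → K} {e c e' c' : ℤ} (hy : HasGrowth v q y e c)
    (hz : HasGrowth v q z e' c') : HasGrowth v q (y * z) (e + e') (c + c') := by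
  obtain ⟨N₀, hy⟩ := hy
  obtain ⟨N₁, hz⟩ := hz
  refine ⟨max N₀ N₁, fun N hN => ?_⟩
  rw [Pi.mul_apply, map_mul, hy N ((le_max_left _ _).trans hN),
    hz N ((le_max_right _ _).trans hN), ← exp_add]
  congr 1
  ring

lemma HasGrowth.shift {y : ℕ → K} {e c : ℤ} (hy : HasGrowth v q y e c) :
    HasGrowth v q (fun N => y (N + 1)) (e * q) c := by
  obtain ⟨N₀, hy⟩ := hy
  refine ⟨N₀, fun N hN => ?_⟩
  rw [hy (N + 1) (by omega), pow_succ]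
  congr 1
  ring

lemma HasGrowth.unique (hq : 2 ≤ q) {y : ℕ → K} {e c e' c' : ℤ} (h : HasGrowth v q y e c)
    (h' : HasGrowth v q y e' c') : e = e' := by
  have key : ∀ {e c e' c' : ℤ}, HasGrowth v q y e c → HasGrowth v q y e' c' → ¬ e < e' := by
    rintro e c e' c' ⟨N₀, h⟩ ⟨N₁, h'⟩ hlt
    obtain ⟨N₂, h2⟩ := exists_forall_lt_of_lt hq hlt c c'
    set N := max N₀ (max N₁ N₂)
    have h3 := h2 N (by simp [N])
    have h4 := (h N (by simp [N])).symm.trans (h' N (by simp [N]))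
    rw [exp_inj] at h4
    omega
  exact le_antisymm (not_lt.1 (key h' h)) (not_lt.1 (key h h'))

/-- The coefficients of a linear relation of the shape satisfied by double zeta values vanish at
all indices prime to the parity condition. -/
theorem coeff_eq_zero_of_relation {A : Subring k} {t : k} (ht : φ t = T)
    (htA : t ∈ A) (hA : ∀ x : k, ∃ δ ∈ A, δ ≠ 0 ∧ δ * x ∈ A)
    (hAv : ∀ x ∈ A, v (φ x) < 1 → x = 0) (hT : v T = exp 1) (hq : 2 ≤ q)
    {n : ℕ} {J : Finset ℕ} (hJ : ∀ j ∈ J, j ≠ 0 ∧ j < n) {c : ℕ → k} {f : ℕ → ℕ → K}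
    {α : ℕ → k[X]} (hfe : ∀ s, s ≠ 0 → HasExpansion φ v T q (f s)) (hf0 : ∀ s, s ≠ 0 → f s 0 ≠ 0)
    (hf : ∀ s, s ≠ 0 → ∀ N, f s (N + 1) =
      evalSeq φ T q (frobDiff t q ^ s) N * (f s N - evalSeq φ T q (α s) N))
    {g : ℕ → K} (hge : HasExpansion φ v T q g)
    (hg : ∀ N, evalSeq φ T q (frobDiff t q ^ n) N * g N = g (N + 1) +
      ∑ j ∈ J, evalSeq φ T q (C (c j) * α j * frobDiff t q ^ j) N * f (n - j) (N + 1))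
    {a : ℕ → k} {b : ℕ → ℕ → k} (ha : HasBoundedDenom A a)
    (hb : ∀ j ∈ J, HasBoundedDenom A (b j)) {κ : ℕ}
    (hbO : ∀ j ∈ J, IsBigO v q (fun N => φ (b j N)) κ)
    (hrel : ∀ N, φ (a N) + ∑ j ∈ J, φ (b j N) * f (n - j) N + g N = 0) :
    ∀ j ∈ J, ¬ (q - 1) ∣ j → c j = 0 := by
  obtain ⟨u₀, u, hu, hflat⟩ := exists_relation_isFlat (ι := Option J) (A := A) ht htA hA hAv hT hq
    (y := fun o => o.elim g fun j => f (n - j)) (a := a) (b := fun o => o.elim 1 fun j => b j)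
    (κ := κ) (i₀ := none)
    (by
      rintro (_ | j)
      · exact hge
      · exact hfe _ (by have := hJ j j.2; omega))
    ha
    (by
      rintro (_ | j)
      · exact HasBoundedDenom.of_mem fun N => A.one_mem
      · exact hb j j.2)
    (by
      rintro (_ | j)
      · exact ((IsBigO.const (φ 1)).mono (by simp))
      · exact hbO j j.2)
    (fun N => rfl)
    (fun N => by
      rw [← hrel N, Fintype.sum_option]
      simp only [Option.elim, Pi.one_apply, map_one, one_mul]
      rw [← Finset.sum_coe_sort J]
      ring)
  obtain ⟨U, hU⟩ : ∃ U : ℕ → k[X], ∀ j : J, u (some j) = U j := by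
    classical
    exact ⟨fun j => if h : j ∈ J then u (some ⟨j, h⟩) else 0, fun j => by simp⟩
  set ug := u none with hug
  have hR : IsFlat v q (evalSeq φ T q u₀ + ∑ j ∈ J, evalSeq φ T q (U j) * f (n - j) +
      evalSeq φ T q ug * g) := by
    convert hflat using 1
    rw [Fintype.sum_option, ← Finset.sum_coe_sort J]
    simp only [Option.elim, hU, ← hug]
    ring
  have hindep : ∀ {u₀ : k[X]} {U : ℕ → k[X]},
      IsFlat v q (evalSeq φ T q u₀ + ∑ j ∈ J, evalSeq φ T q (U j) * f (n - j)) →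
      u₀ = 0 ∧ ∀ j ∈ J, U j = 0 := fun h =>
    eq_zero_of_isFlat_sum (f := fun j => f (n - j)) (α := fun j => α (n - j)) hT ht hq J
      (fun j => n - j) (fun j hj => by have := hJ j hj; omega)
      (fun i hi j hj hij => by
        have h1 := hJ i hi
        have h2 := hJ j hj
        simp only at hij
        omega)
      (fun j hj => hf0 _ (by have := hJ j hj; omega))
      (fun j hj => hf _ (by have := hJ j hj; omega)) h
  have hug0 : ug ≠ 0 := by
    intro h0
    rw [h0, map_zero, zero_mul, add_zero] at hR
    obtain ⟨h1, h2⟩ := hindep hR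
    refine hu.elim (fun h => h h1) fun h => h (funext fun o => ?_)
    cases o with
    | none => exact h0
    | some j => rw [hU, h2 j j.2]; rfl
  have hD := frobDiff_ne_zero t (q := q) (by omega)
  have hE : ∀ j ∈ J, ug * expand k q (U j) =
      expand k q ug * frobDiff t q ^ j * (U j + ug * (C (c j) * α j)) := by
    have hRs : IsFlat v q (evalSeq φ T q (expand k q u₀) +
        ∑ j ∈ J, evalSeq φ T q (expand k q (U j)) * (fun N => f (n - j) (N + 1)) +
        evalSeq φ T q (expand k q ug) * fun N => g (N + 1)) := by
      convert hR.shift (by omega) using 1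
      funext N
      simp [evalSeq_expand]
    have h1 := (IsFlat.mul_of_isBigO (isBigO_evalSeq hT (φ := φ) (q := q)
      (expand k q ug * frobDiff t q ^ n) le_rfl) hR).sub
      (IsFlat.mul_of_isBigO (isBigO_evalSeq hT (φ := φ) (q := q) ug le_rfl) hRs)
    have h2 := (hindep
      (u₀ := expand k q ug * frobDiff t q ^ n * u₀ - ug * expand k q u₀ -
        ∑ j ∈ J, (ug * (expand k q ug * (C (c j) * α j * frobDiff t q ^ j) - expand k q (U j))) *
          frobDiff t q ^ (n - j) * α (n - j))
      (U := fun j => expand k q ug * frobDiff t q ^ n * U j +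
        (ug * (expand k q ug * (C (c j) * α j * frobDiff t q ^ j) - expand k q (U j))) *
          frobDiff t q ^ (n - j)) (by
      convert h1 using 1
      funext N
      have h3 : ∀ j ∈ J, f (n - j) (N + 1) = evalSeq φ T q (frobDiff t q ^ (n - j)) N *
          (f (n - j) N - evalSeq φ T q (α (n - j)) N) :=
        fun j hj => hf _ (by have := hJ j hj; omega) N
      have h4 := hg N
      have h5 : ∑ j ∈ J, evalSeq φ T q (expand k q ug * frobDiff t q ^ n * U j +
          (ug * (expand k q ug * (C (c j) * α j * frobDiff t q ^ j) - expand k q (U j))) *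
          frobDiff t q ^ (n - j)) N * f (n - j) N =
          evalSeq φ T q (expand k q ug * frobDiff t q ^ n) N *
            ∑ j ∈ J, evalSeq φ T q (U j) N * f (n - j) N +
          evalSeq φ T q ug N * (evalSeq φ T q (expand k q ug) N *
            ∑ j ∈ J, evalSeq φ T q (C (c j) * α j * frobDiff t q ^ j) N * f (n - j) (N + 1) -
            ∑ j ∈ J, evalSeq φ T q (expand k q (U j)) N * f (n - j) (N + 1)) +
          ∑ j ∈ J, evalSeq φ T q ((ug * (expand k q ug * (C (c j) * α j * frobDiff t q ^ j) -
            expand k q (U j))) * frobDiff t q ^ (n - j) * α (n - j)) N := by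
        simp only [Finset.mul_sum, ← Finset.sum_add_distrib, ← Finset.sum_sub_distrib]
        refine Finset.sum_congr rfl fun j hj => ?_
        rw [h3 j hj]
        simp only [map_mul, map_add, map_sub, Pi.mul_apply, Pi.add_apply, Pi.sub_apply]
        ring
      simp only [Pi.add_apply, Finset.sum_apply, Pi.mul_apply, map_sub, map_sum, map_mul,
        Pi.sub_apply] at h5 h4 ⊢
      rw [h5]
      linear_combination -evalSeq φ T q (expand k q ug) N * evalSeq φ T q ug N * h4)).2
    intro j hj
    have h3 := h2 j hj
    have h4 : frobDiff t q ^ n = frobDiff t q ^ j * frobDiff t q ^ (n - j) := by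
      rw [← pow_add]
      congr 1
      have := hJ j hj
      omega
    rw [h4] at h3
    refine mul_right_cancel₀ (pow_ne_zero (n - j) hD) ?_
    linear_combination -h3
  intro j hj hdvd
  have hj0 := (hJ j hj).1
  set y := evalSeq φ T q (U j) + evalSeq φ T q (ug * C (c j)) * f j with hy
  have hye : HasExpansion φ v T q y :=
    (HasExpansion.evalSeq _).add hT ((hfe j hj0).mul_evalSeq hT _)
  have hys : evalSeq φ T q ug * (fun N => y (N + 1)) =
      (fun N => evalSeq φ T q ug (N + 1)) * evalSeq φ T q (frobDiff t q ^ j) * y := by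
    funext N
    have h1 := congrFun (congrArg (evalSeq φ T q) (hE j hj)) N
    simp only [map_mul, map_add, Pi.mul_apply, Pi.add_apply, evalSeq_expand] at h1
    simp only [hy, Pi.mul_apply, Pi.add_apply, hf j hj0, map_mul, evalSeq_C] at h1 ⊢
    linear_combination h1
  rcases hye.isFlat_or_hasGrowth hT hq with hyf | ⟨e, d, hyg⟩
  · have h1 := (eq_zero_of_isFlat_sum hT ht hq {j} id (by simpa using hj0) (by simp)
      (f := f) (α := α) (by simpa using hf0 j hj0) (by simpa using hf j hj0)
      (u₀ := U j) (u := fun j => ug * C (c j)) (by simpa [hy] using hyf)).2 j (by simp)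
    simpa [hug0] using h1
  · exfalso
    obtain ⟨d₁, h1⟩ := hasGrowth_evalSeq (φ := φ) hT hq hug0
    obtain ⟨d₂, h2⟩ := hasGrowth_evalSeq (φ := φ) hT hq (pow_ne_zero j hD)
    have h3 := (h1.mul hyg.shift).unique hq (hys ▸ (h1.shift.mul h2).mul hyg)
    rw [natDegree_pow, natDegree_frobDiff] at h3
    apply hdvd
    obtain ⟨p, rfl⟩ : ∃ p, q = p + 1 := ⟨q - 1, by omega⟩
    rw [Nat.add_sub_cancel]
    zify
    refine ⟨e - ug.natDegree - j, ?_⟩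
    push_cast at h3
    linear_combination -h3

end Independence

section Carlitz

variable {k : Type*} [Field k]

/-- `ℓ_d = ∏_{i = 1}^d (θ - θ ^ (q ^ i))`. -/
def carlitzL (t : k) (q d : ℕ) : k := ∏ i ∈ Finset.range d, (t - t ^ q ^ (i + 1))

/-- The Carlitz factorials, `D_0 = 1` and `D_{i + 1} = (θ ^ (q ^ (i + 1)) - θ) * D_i ^ q`. -/
def carlitzD (t : k) (q : ℕ) : ℕ → k
  | 0 => 1
  | i + 1 => (t ^ q ^ (i + 1) - t) * carlitzD t q i ^ q

/-- The polynomial `∏_{j = 1}^i (θ ^ (q ^ i) - X ^ (q ^ j))`. -/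
noncomputable def carlitzG (t : k) (q i : ℕ) : k[X] :=
  ∏ j ∈ Finset.range i, (C (t ^ q ^ i) - X ^ q ^ (j + 1))

/-- The coefficients of the Carlitz polynomial `E_d`. -/
noncomputable def carlitzCoeff (t : k) (q d i : ℕ) : k :=
  (carlitzG t q i).eval (t ^ q ^ d) / (carlitzD t q i * carlitzL t q d ^ q ^ i)

/-- The value of the Carlitz polynomial `E_d`, normalised to be `1` at the monic polynomials of
degree `d`. -/
noncomputable def carlitzE (t : k) (q d : ℕ) (x : k) : k :=
  ∑ i ∈ Finset.range (d + 1), carlitzCoeff t q d i * x ^ q ^ i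

lemma carlitzL_succ (t : k) (q d : ℕ) :
    carlitzL t q (d + 1) = carlitzL t q d * (t - t ^ q ^ (d + 1)) := Finset.prod_range_succ _ _

lemma eval_carlitzG (t : k) (q d i : ℕ) : (carlitzG t q i).eval (t ^ q ^ d) =
    ∏ j ∈ Finset.range i, (t ^ q ^ i - t ^ q ^ (d + j + 1)) := by
  simp only [carlitzG, eval_prod, eval_sub, eval_C, eval_pow, eval_X, ← pow_mul, ← pow_add,
    add_assoc]

lemma carlitzCoeff_eq_zero (t : k) (q : ℕ) {d i : ℕ} (h : d < i) : carlitzCoeff t q d i = 0 := by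
  rw [carlitzCoeff, eval_carlitzG, Finset.prod_eq_zero (i := i - d - 1) (by simp; omega), zero_div]
  rw [show d + (i - d - 1) + 1 = i by omega, sub_self]

lemma carlitzCoeff_zero_right (t : k) (q d : ℕ) : carlitzCoeff t q d 0 = (carlitzL t q d)⁻¹ := by
  simp [carlitzCoeff, carlitzG, carlitzD]

lemma carlitzE_eq_sum (t : k) (q : ℕ) {d n : ℕ} (h : d < n) (x : k) :
    carlitzE t q d x = ∑ i ∈ Finset.range n, carlitzCoeff t q d i * x ^ q ^ i := by
  refine Finset.sum_subset (by simpa using h) fun i _ hi => ?_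
  rw [carlitzCoeff_eq_zero t q (by simpa using hi), zero_mul]

variable {F : Type*} [Field F] [Algebra F k] {q : ℕ} {t : k}

lemma pow_pow_injective (ht : Transcendental F t) (hq : 2 ≤ q) {i j : ℕ}
    (h : t ^ q ^ i = t ^ q ^ j) : i = j := by
  have h1 : (X ^ q ^ i : F[X]) = X ^ q ^ j := by
    refine transcendental_iff_injective.1 ht ?_
    simpa using h
  have h2 := congrArg natDegree h1
  rw [natDegree_X_pow, natDegree_X_pow] at h2
  exact Nat.pow_right_injective hq h2

lemma carlitzL_ne_zero (ht : Transcendental F t) (hq : 2 ≤ q) (d : ℕ) : carlitzL t q d ≠ 0 := by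
  refine Finset.prod_ne_zero_iff.2 fun i _ h => ?_
  have := pow_pow_injective ht hq (i := 0) (j := i + 1) (by simpa using sub_eq_zero.1 h)
  omega

lemma pow_sub_ne_zero (ht : Transcendental F t) (hq : 2 ≤ q) (i : ℕ) :
    t ^ q ^ (i + 1) - t ≠ 0 := fun h => by
  have := pow_pow_injective ht hq (i := i + 1) (j := 0) (by simpa using sub_eq_zero.1 h)
  omega

lemma carlitzD_ne_zero (ht : Transcendental F t) (hq : 2 ≤ q) (i : ℕ) : carlitzD t q i ≠ 0 := by
  induction i with
  | zero => exact one_ne_zero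
  | succ i ih => exact mul_ne_zero (pow_sub_ne_zero ht hq i) (pow_ne_zero _ ih)

variable [Fintype F]

lemma two_le_of_card_eq (hq : Fintype.card F = q) : 2 ≤ q := hq ▸ Fintype.one_lt_card

lemma add_pow_card_pow (hq : Fintype.card F = q) (x y : k) (i : ℕ) :
    (x + y) ^ q ^ i = x ^ q ^ i + y ^ q ^ i := by
  induction i with
  | zero => simp
  | succ i ih =>
    rw [pow_succ, pow_mul, ih, pow_mul, pow_mul, ← hq]
    exact map_add (FiniteField.frobeniusAlgHom F k) _ _

lemma sub_pow_card_pow (hq : Fintype.card F = q) (x y : k) (i : ℕ) :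
    (x - y) ^ q ^ i = x ^ q ^ i - y ^ q ^ i := by
  rw [eq_sub_iff_add_eq, ← add_pow_card_pow hq, sub_add_cancel]

lemma sum_pow_card (hq : Fintype.card F = q) {ι : Type*} (s : Finset ι) (f : ι → k) :
    (∑ i ∈ s, f i) ^ q = ∑ i ∈ s, f i ^ q := by
  subst hq
  exact map_sum (FiniteField.frobeniusAlgHom F k) f s

lemma algebraMap_pow_card_pow (hq : Fintype.card F = q) (c : F) (i : ℕ) :
    algebraMap F k c ^ q ^ i = algebraMap F k c := by
  rw [← map_pow, ← hq, FiniteField.pow_card_pow]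

lemma carlitzCoeff_succ_succ (ht : Transcendental F t) (hq : Fintype.card F = q) (d i : ℕ) :
    (t ^ q ^ (i + 1) - t) * carlitzCoeff t q (d + 1) (i + 1) = carlitzCoeff t q d i ^ q := by
  have hq2 := two_le_of_card_eq hq
  have h1 := pow_sub_ne_zero ht hq2 i
  have h2 := carlitzD_ne_zero ht hq2 i
  have h3 := carlitzL_ne_zero ht hq2 d
  have h4 := carlitzL_ne_zero ht hq2 (d + 1)
  rw [carlitzL_succ] at h4
  have h5 := right_ne_zero_of_mul h4
  have h6 : (t - t ^ q ^ (d + 1)) ^ q ^ (i + 1) = t ^ q ^ (i + 1) - t ^ q ^ (d + 1 + i + 1) := by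
    rw [sub_pow_card_pow hq, ← pow_mul, ← pow_add, ← add_assoc]
  rw [carlitzCoeff, carlitzCoeff, eval_carlitzG, eval_carlitzG, carlitzD, carlitzL_succ,
    Finset.prod_range_succ, ← h6, div_pow, ← Finset.prod_pow, mul_pow, mul_pow,
    ← pow_mul (carlitzL t q d), ← pow_succ]
  rw [Finset.prod_congr rfl fun j _ => show (t ^ q ^ i - t ^ q ^ (d + j + 1)) ^ q =
    t ^ q ^ (i + 1) - t ^ q ^ (d + 1 + j + 1) by
      have := sub_pow_card_pow hq (t ^ q ^ i) (t ^ q ^ (d + j + 1)) 1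
      rw [pow_one, ← pow_mul, ← pow_succ, ← pow_mul, ← pow_succ] at this
      rw [this, add_right_comm d 1 j]]
  field_simp

lemma carlitzCoeff_succ_left (ht : Transcendental F t) (hq : Fintype.card F = q) (d i : ℕ) :
    carlitzCoeff t q d i = (t ^ q ^ i - t ^ q ^ (d + 1)) * carlitzCoeff t q (d + 1) i := by
  have hq2 := two_le_of_card_eq hq
  have h2 := carlitzD_ne_zero ht hq2 i
  have h3 := carlitzL_ne_zero ht hq2 d
  have h4 := carlitzL_ne_zero ht hq2 (d + 1)
  rw [carlitzL_succ] at h4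
  have h5 := right_ne_zero_of_mul h4
  have h6 : (t - t ^ q ^ (d + 1)) ^ q ^ i = t ^ q ^ i - t ^ q ^ (d + i + 1) := by
    rw [sub_pow_card_pow hq, ← pow_mul, ← pow_add, add_right_comm]
  have h7 : (t ^ q ^ i - t ^ q ^ (d + 1)) *
      ∏ j ∈ Finset.range i, (t ^ q ^ i - t ^ q ^ (d + 1 + j + 1)) =
      (∏ j ∈ Finset.range i, (t ^ q ^ i - t ^ q ^ (d + j + 1))) *
        (t - t ^ q ^ (d + 1)) ^ q ^ i := by
    rw [h6, ← Finset.prod_range_succ (fun j => t ^ q ^ i - t ^ q ^ (d + j + 1)),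
      Finset.prod_range_succ', mul_comm]
    simp only [add_zero, add_assoc, add_comm 1]
  rw [carlitzCoeff, carlitzCoeff, eval_carlitzG, eval_carlitzG, carlitzL_succ, mul_pow,
    ← mul_div_assoc,
    h7]
  field_simp

lemma carlitzE_add (hq : Fintype.card F = q) (d : ℕ) (x y : k) :
    carlitzE t q d (x + y) = carlitzE t q d x + carlitzE t q d y := by
  simp only [carlitzE, add_pow_card_pow hq, mul_add, Finset.sum_add_distrib]

lemma carlitzE_algebraMap_mul (hq : Fintype.card F = q) (d : ℕ) (c : F) (x : k) :
    carlitzE t q d (algebraMap F k c * x) = algebraMap F k c * carlitzE t q d x := by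
  simp only [carlitzE, mul_pow, algebraMap_pow_card_pow hq, Finset.mul_sum]
  exact Finset.sum_congr rfl fun i _ => by ring

lemma carlitzE_pow (ht : Transcendental F t) (hq : Fintype.card F = q) (d : ℕ) (x : k) :
    carlitzE t q d x ^ q = ∑ i ∈ Finset.range (d + 2),
      (t ^ q ^ i - t) * carlitzCoeff t q (d + 1) i * x ^ q ^ i := by
  rw [Finset.sum_range_succ', carlitzE, sum_pow_card hq]
  simp only [pow_zero, pow_one, sub_self, zero_mul, add_zero]
  refine Finset.sum_congr rfl fun i _ => ?_
  rw [carlitzCoeff_succ_succ ht hq, mul_pow, ← pow_mul, ← pow_succ]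

lemma carlitzE_mul_self (ht : Transcendental F t) (hq : Fintype.card F = q) (d : ℕ) (x : k) :
    carlitzE t q (d + 1) (t * x) = t * carlitzE t q (d + 1) x + carlitzE t q d x ^ q := by
  rw [carlitzE_pow ht hq, carlitzE, carlitzE, Finset.mul_sum, ← Finset.sum_add_distrib]
  exact Finset.sum_congr rfl fun i _ => by rw [mul_pow]; ring

lemma carlitzE_succ (ht : Transcendental F t) (hq : Fintype.card F = q) (d : ℕ) (x : k) :
    (t ^ q ^ (d + 1) - t) * carlitzE t q (d + 1) x = carlitzE t q d x ^ q - carlitzE t q d x := by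
  rw [carlitzE_pow ht hq, carlitzE_eq_sum t q (show d < d + 2 by omega), carlitzE,
    Finset.mul_sum, ← Finset.sum_sub_distrib]
  exact Finset.sum_congr rfl fun i _ => by rw [carlitzCoeff_succ_left ht hq d i]; ring

lemma carlitzE_zero (x : k) : carlitzE t q 0 x = x := by
  simp [carlitzE, carlitzCoeff_zero_right, carlitzL]

lemma carlitzE_succ_eq_zero (ht : Transcendental F t) (hq : Fintype.card F = q) {d : ℕ} {x : k}
    (h : carlitzE t q d x = 0 ∨ carlitzE t q d x = 1) : carlitzE t q (d + 1) x = 0 := by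
  have h1 := carlitzE_succ ht hq d x
  have hq2 := two_le_of_card_eq hq
  have h2 : carlitzE t q d x ^ q - carlitzE t q d x = 0 := by
    rcases h with h | h
    · rw [h, zero_pow (by omega), sub_zero]
    · rw [h, one_pow, sub_self]
  rw [h2] at h1
  exact (mul_eq_zero.1 h1).resolve_left (pow_sub_ne_zero ht hq2 d)

lemma carlitzE_succ_one (ht : Transcendental F t) (hq : Fintype.card F = q) (d : ℕ) :
    carlitzE t q (d + 1) 1 = 0 := by
  induction d with
  | zero => exact carlitzE_succ_eq_zero ht hq (Or.inr (carlitzE_zero _))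
  | succ d ih => exact carlitzE_succ_eq_zero ht hq (Or.inl ih)

lemma carlitzE_aeval_eq_one (ht : Transcendental F t) (hq : Fintype.card F = q) {p : F[X]}
    (hp : p.Monic) : carlitzE t q p.natDegree (aeval t p) = 1 := by
  obtain ⟨d, hd⟩ : ∃ d, p.natDegree = d := ⟨_, rfl⟩
  rw [hd]
  induction d generalizing p with
  | zero => rw [hp.natDegree_eq_zero.1 hd, map_one, carlitzE_zero]
  | succ d ih =>
    have hd' : p.divX.natDegree = d := by rw [natDegree_divX_eq_natDegree_tsub_one, hd]; rfl
    have hp' : p.divX.Monic := by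
      rw [Monic, leadingCoeff, hd', coeff_divX, ← hd]
      exact hp
    have h1 := ih hp' hd'
    rw [← X_mul_divX_add p, map_add, map_mul, aeval_X, aeval_C, carlitzE_add hq,
      carlitzE_mul_self ht hq, h1, carlitzE_succ_eq_zero ht hq (Or.inr h1),
      ← mul_one (algebraMap _ _ _), carlitzE_algebraMap_mul hq, carlitzE_succ_one ht hq]
    simp

end Carlitz

section PowerSums

variable {F : Type*} [Field F] [Fintype F]

lemma finite_monic_natDegree (F : Type*) [Field F] [Finite F] (d : ℕ) :
    {p : F[X] | p.Monic ∧ p.natDegree = d}.Finite :=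
  Set.finite_coe_iff.1 <|
    Finite.of_equiv _ ((monicEquivDegreeLT d).trans (degreeLTEquiv F d).toEquiv).symm

/-- The finite set of monic polynomials of degree `d`. -/
noncomputable def monicFinset (F : Type*) [Field F] [Finite F] (d : ℕ) : Finset F[X] :=
  (finite_monic_natDegree F d).toFinset

lemma mem_monicFinset {d : ℕ} {p : F[X]} : p ∈ monicFinset F d ↔ p.Monic ∧ p.natDegree = d := by
  simp [monicFinset]

lemma card_monicFinset (d : ℕ) : (monicFinset F d).card = Fintype.card F ^ d := by
  rw [monicFinset, ← Nat.card_eq_card_finite_toFinset]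
  refine (Nat.card_congr ((monicEquivDegreeLT d).trans (degreeLTEquiv F d).toEquiv)).trans ?_
  simp

variable {k : Type*} [Field k] [Algebra F k] {q : ℕ} {t : k}

/-- The power sum `S_d(s) = ∑ a ^ (-s)` over the monic polynomials `a` of degree `d`. -/
noncomputable def powerSum (F : Type*) [Field F] [Finite F] {k : Type*} [Field k] [Algebra F k]
    (t : k) (d s : ℕ) : k :=
  ∑ a ∈ monicFinset F d, ((aeval t a)⁻¹) ^ s

/-- The polynomial `1 - E_d`. -/
noncomputable def oneSubCarlitz (t : k) (q d : ℕ) : k[X] :=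
  1 - ∑ i ∈ Finset.range (d + 1), C (carlitzCoeff t q d i) * X ^ q ^ i

lemma aeval_ne_zero (ht : Transcendental F t) {d : ℕ} {a : F[X]} (ha : a ∈ monicFinset F d) :
    aeval t a ≠ 0 := fun h =>
  (mem_monicFinset.1 ha).1.ne_zero (transcendental_iff.1 ht a h)

lemma oneSubCarlitz_eq_prod (ht : Transcendental F t) (hq : Fintype.card F = q) (d : ℕ) :
    oneSubCarlitz t q d = ∏ a ∈ monicFinset F d, (1 - C (aeval t a)⁻¹ * X) := by
  classical
  have hq2 := two_le_of_card_eq hq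
  have hinj : Function.Injective (aeval t : F[X] →ₐ[F] k) := transcendental_iff_injective.1 ht
  refine eq_of_natDegree_lt_card_of_eval_eq' _ _
    (insert 0 ((monicFinset F d).image (aeval t))) ?_ ?_
  · intro x hx
    rcases Finset.mem_insert.1 hx with rfl | hx
    · simp [oneSubCarlitz, eval_finsetSum, eval_prod, zero_pow (pow_ne_zero _ (by omega : q ≠ 0))]
    · obtain ⟨a, ha, rfl⟩ := Finset.mem_image.1 hx
      have h1 := carlitzE_aeval_eq_one ht hq (mem_monicFinset.1 ha).1
      rw [(mem_monicFinset.1 ha).2] at h1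
      rw [eval_prod, Finset.prod_eq_zero ha (by simp [aeval_ne_zero ht ha])]
      simp only [oneSubCarlitz, eval_sub, eval_one, eval_finsetSum, eval_mul, eval_C, eval_pow,
        eval_X]
      rw [← carlitzE, h1, sub_self]
  · rw [Finset.card_insert_of_notMem, Finset.card_image_of_injective _ hinj, card_monicFinset, hq,
      Nat.lt_succ_iff, max_le_iff]
    · constructor
      · refine (natDegree_sub_le _ _).trans (max_le (by simp) ?_)
        refine natDegree_sum_le_of_forall_le _ _ fun i hi => (natDegree_C_mul_X_pow_le _ _).trans ?_
        exact Nat.pow_le_pow_right (by omega) (by simpa [Nat.lt_succ_iff] using hi)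
      · refine (natDegree_prod_le _ _).trans ?_
        refine (Finset.sum_le_card_nsmul _ _ 1 fun a _ => ?_).trans (by simp [card_monicFinset, hq])
        refine (natDegree_sub_le _ _).trans (max_le (by simp) ?_)
        simpa using natDegree_C_mul_X_pow_le (aeval t a)⁻¹ 1
    · intro h
      obtain ⟨a, ha, h0⟩ := Finset.mem_image.1 h
      exact aeval_ne_zero ht ha h0

lemma derivative_oneSubCarlitz (hq : Fintype.card F = q) (d : ℕ) :
    derivative (oneSubCarlitz t q d) = -C (carlitzL t q d)⁻¹ := by
  have hq0 : (q : k) = 0 := by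
    rw [← hq, ← map_natCast (algebraMap F k), FiniteField.cast_card_eq_zero, map_zero]
  rw [oneSubCarlitz, derivative_sub, derivative_one, zero_sub, derivative_sum,
    Finset.sum_range_succ', Finset.sum_eq_zero]
  · simp [carlitzCoeff_zero_right]
  · intro i _
    rw [derivative_C_mul_X_pow]
    simp [hq0]

/-- Newton's identity for the power sums of the reciprocal roots of a polynomial. -/
lemma prod_mul_mk_sum_pow {ι : Type*} (s : Finset ι) (b : ι → k) :
    ((∏ a ∈ s, (1 - C (b a) * X) : k[X]) : PowerSeries k) *
      PowerSeries.mk (fun n => ∑ a ∈ s, b a ^ (n + 1)) =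
      ((-derivative (∏ a ∈ s, (1 - C (b a) * X)) : k[X]) : PowerSeries k) := by
  classical
  have h1 : PowerSeries.mk (fun n => ∑ a ∈ s, b a ^ (n + 1)) =
      ∑ a ∈ s, PowerSeries.mk (fun n => b a ^ (n + 1)) := by
    ext n
    simp
  have h2 : ∀ c : k, (((1 - C c * X : k[X])) : PowerSeries k) *
      PowerSeries.mk (fun n => c ^ (n + 1)) = ((C c : k[X]) : PowerSeries k) := by
    intro c
    ext n
    rw [Polynomial.coe_sub, Polynomial.coe_mul, Polynomial.coe_one, Polynomial.coe_C,
      Polynomial.coe_X, sub_mul, one_mul, mul_assoc, map_sub, PowerSeries.coeff_C_mul]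
    cases n with
    | zero => simp
    | succ n =>
      rw [PowerSeries.coeff_succ_X_mul, PowerSeries.coeff_C]
      simp [pow_succ']
  rw [h1, Finset.mul_sum, derivative_prod_finset, ← Finset.sum_neg_distrib]
  rw [← Polynomial.coeToPowerSeries.ringHom_apply
    (φ := ∑ a ∈ s, -((∏ b_1 ∈ s.erase a, (1 - C (b b_1) * X)) * derivative (1 - C (b a) * X))),
    map_sum]
  refine Finset.sum_congr rfl fun a ha => ?_
  rw [← Finset.prod_erase_mul _ _ ha, Polynomial.coe_mul, mul_assoc, h2,
    Polynomial.coeToPowerSeries.ringHom_apply, ← Polynomial.coe_mul]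
  congr 1
  simp

lemma powerSum_one (ht : Transcendental F t) (hq : Fintype.card F = q) (d : ℕ) :
    powerSum F t d 1 = (carlitzL t q d)⁻¹ := by
  have h := prod_mul_mk_sum_pow (monicFinset F d) fun a => (aeval t a)⁻¹
  rw [← oneSubCarlitz_eq_prod ht hq, derivative_oneSubCarlitz hq, neg_neg] at h
  have h1 := congrArg (PowerSeries.coeff 0) h
  have hq2 := two_le_of_card_eq hq
  rw [PowerSeries.coeff_mul] at h1
  simpa [oneSubCarlitz, powerSum, coeff_X_pow, (pow_ne_zero _ (by omega : q ≠ 0)).symm] using h1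

lemma powerSum_add_two (ht : Transcendental F t) (hq : Fintype.card F = q) (d s : ℕ) :
    powerSum F t d (s + 2) = ∑ i ∈ (Finset.range (s + 1)).filter (fun i => q ^ i ≤ s + 1),
      carlitzCoeff t q d i * powerSum F t d (s + 2 - q ^ i) := by
  have h := prod_mul_mk_sum_pow (monicFinset F d) fun a => (aeval t a)⁻¹
  rw [← oneSubCarlitz_eq_prod ht hq, derivative_oneSubCarlitz hq, neg_neg] at h
  have h1 := congrArg (PowerSeries.coeff (s + 1)) h
  have hq2 := two_le_of_card_eq hq
  have h2 : ((oneSubCarlitz t q d : k[X]) : PowerSeries k) = 1 - ∑ i ∈ Finset.range (d + 1),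
      PowerSeries.C (carlitzCoeff t q d i) * PowerSeries.X ^ q ^ i := by
    rw [oneSubCarlitz, ← Polynomial.coeToPowerSeries.ringHom_apply, map_sub, map_sum]
    simp
  have h3 : ∑ i ∈ Finset.range (d + 1), carlitzCoeff t q d i *
      (if q ^ i ≤ s + 1 then powerSum F t d (s + 2 - q ^ i) else 0) =
      ∑ i ∈ Finset.range (s + 1), carlitzCoeff t q d i *
      (if q ^ i ≤ s + 1 then powerSum F t d (s + 2 - q ^ i) else 0) := by
    rw [Finset.sum_subset (Finset.range_subset_range.2 (Nat.le_add_right (d + 1) (s + 1))),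
      Finset.sum_subset (Finset.range_subset_range.2 (Nat.le_add_left (s + 1) (d + 1)))]
    · intro i _ hi
      have h4 : i < q ^ i := Nat.lt_pow_self (by omega)
      rw [if_neg (by simp at hi; omega), mul_zero]
    · intro i _ hi
      rw [carlitzCoeff_eq_zero t q (by simpa using hi), zero_mul]
  rw [h2, sub_mul, one_mul, Finset.sum_mul, map_sub, PowerSeries.coeff_mk, map_sum,
    Polynomial.coe_C, PowerSeries.coeff_C, if_neg (Nat.succ_ne_zero s)] at h1
  simp only [mul_ite, mul_zero] at h3
  rw [Finset.sum_filter, ← h3]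
  refine (sub_eq_zero.1 h1).trans ?_
  refine Finset.sum_congr rfl fun i _ => ?_
  rw [mul_assoc, PowerSeries.coeff_C_mul, PowerSeries.coeff_X_pow_mul']
  split_ifs with hi
  · rw [PowerSeries.coeff_mk, powerSum, show s + 1 - q ^ i + 1 = s + 2 - q ^ i by omega]
  · rw [mul_zero]

lemma natDegree_carlitzG_le (t : k) (hq : 2 ≤ q) (i : ℕ) :
    (q - 1) * (carlitzG t q i).natDegree ≤ q * (q ^ i - 1) := by
  have h1 : (carlitzG t q i).natDegree ≤ ∑ j ∈ Finset.range i, q ^ (j + 1) := by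
    refine (natDegree_prod_le _ _).trans (Finset.sum_le_sum fun j _ => ?_)
    exact (natDegree_sub_le _ _).trans (max_le (by simp) (by simp))
  refine (Nat.mul_le_mul_left _ h1).trans (le_of_eq ?_)
  have h2 := Nat.geomSum_eq hq i
  simp only [pow_succ', ← Finset.mul_sum]
  rw [mul_left_comm, h2, Nat.mul_div_cancel' (Nat.sub_one_dvd_pow_sub_one q i)]

/-- The power sums `S_d(s)`, for fixed `s`, are interpolated by a polynomial in `θ ^ (q ^ d)`. -/
lemma exists_powerSum_polynomial (ht : Transcendental F t) (hq : Fintype.card F = q) {s : ℕ}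
    (hs : s ≠ 0) : ∃ α : k[X],
      (∀ d, powerSum F t d s * carlitzL t q d ^ s = α.eval (t ^ q ^ d)) ∧
      (q - 1) * α.natDegree ≤ q * (s - 1) := by
  have hq2 := two_le_of_card_eq hq
  induction s using Nat.strong_induction_on with
  | _ s ih =>
    obtain _ | _ | s := s
    · exact absurd rfl hs
    · refine ⟨1, fun d => ?_, by simp⟩
      rw [powerSum_one ht hq]
      simp [carlitzL_ne_zero ht hq2]
    · have h1 : ∀ i, ∃ β : k[X], q ^ i ≤ s + 1 →
          (∀ d, powerSum F t d (s + 2 - q ^ i) * carlitzL t q d ^ (s + 2 - q ^ i) =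
            β.eval (t ^ q ^ d)) ∧ (q - 1) * β.natDegree ≤ q * (s + 2 - q ^ i - 1) := by
        intro i
        have : 0 < q ^ i := by positivity
        by_cases h : q ^ i ≤ s + 1
        · obtain ⟨β, hβ⟩ := ih (s + 2 - q ^ i) (by omega) (by omega)
          exact ⟨β, fun _ => hβ⟩
        · exact ⟨0, fun h' => absurd h' h⟩
      choose β hβ using h1
      refine ⟨∑ i ∈ (Finset.range (s + 1)).filter (fun i => q ^ i ≤ s + 1),
        C (carlitzD t q i)⁻¹ * carlitzG t q i * β i, fun d => ?_, ?_⟩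
      · rw [powerSum_add_two ht hq, Finset.sum_mul, eval_finsetSum]
        refine Finset.sum_congr rfl fun i hi => ?_
        have hi2 := (Finset.mem_filter.1 hi).2
        have hD := carlitzD_ne_zero ht hq2 i
        have hL := carlitzL_ne_zero ht hq2 d
        rw [eval_mul, eval_mul, eval_C, ← (hβ i hi2).1 d, carlitzCoeff,
          show carlitzL t q d ^ (s + 1 + 1) = carlitzL t q d ^ q ^ i *
            carlitzL t q d ^ (s + 2 - q ^ i) by rw [← pow_add]; congr 1; omega]
        field_simp
      · have h2 : ∀ m : ℕ, (q - 1) * m ≤ q * (s + 1) ↔ m ≤ q * (s + 1) / (q - 1) := fun m => by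
          rw [Nat.le_div_iff_mul_le (by omega), mul_comm]
        rw [Nat.add_sub_cancel, h2]
        refine natDegree_sum_le_of_forall_le _ _ fun i hi => (h2 _).1 ?_
        have hi2 := (Finset.mem_filter.1 hi).2
        have h3 : 0 < q ^ i := by positivity
        calc (q - 1) * (C (carlitzD t q i)⁻¹ * carlitzG t q i * β i).natDegree
            ≤ (q - 1) * ((carlitzG t q i).natDegree + (β i).natDegree) :=
              Nat.mul_le_mul_left _ (natDegree_mul_le.trans
                (Nat.add_le_add_right (natDegree_C_mul_le _ _) _))
          _ ≤ q * (q ^ i - 1) + q * (s + 2 - q ^ i - 1) := by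
              rw [mul_add]
              exact Nat.add_le_add (natDegree_carlitzG_le t hq2 i) (hβ i hi2).2
          _ ≤ q * (s + 1) := by
              rw [← mul_add]
              exact Nat.mul_le_mul_left _ (by omega)

end PowerSums

section Tails

open WithZero

variable {k K : Type*} [Field k] [Field K] {v : Valuation K ℤᵐ⁰} {q : ℕ} {φ : k →+* K} {T : K}

/-- The sequence `y` tends to zero with respect to the valuation `v`. -/
def TendsToZero (v : Valuation K ℤᵐ⁰) (y : ℕ → K) : Prop :=
  ∀ C : ℤ, ∃ N₀, ∀ N, N₀ ≤ N → v (y N) ≤ exp C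

lemma TendsToZero.sub {y z : ℕ → K} (hy : TendsToZero v y) (hz : TendsToZero v z) :
    TendsToZero v (y - z) := fun C => by
  obtain ⟨N₀, h⟩ := hy C
  obtain ⟨N₁, h'⟩ := hz C
  exact ⟨max N₀ N₁, fun N hN => v.map_sub_le (h N ((le_max_left _ _).trans hN))
    (h' N ((le_max_right _ _).trans hN))⟩

lemma TendsToZero.mul_of_le_one {y z : ℕ → K} (hz : ∀ N, v (z N) ≤ 1) (hy : TendsToZero v y) :
    TendsToZero v (z * y) := fun C => by
  obtain ⟨N₀, h⟩ := hy C
  refine ⟨N₀, fun N hN => ?_⟩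
  rw [Pi.mul_apply, map_mul]
  exact (mul_le_of_le_one_left' (hz N)).trans (h N hN)

lemma TendsToZero.isBigO {τ : ℕ → K} (hτ : TendsToZero v τ) (hq : 1 ≤ q)
    (h : IsBigO v q (fun N => τ N - τ (N + 1)) (-1)) : IsBigO v q τ (-1) := by
  obtain ⟨C, hC⟩ := h
  refine ⟨C, fun N => ?_⟩
  have key : ∀ M, v (τ N - τ (N + M)) ≤ exp (-1 * (q : ℤ) ^ N + C) := by
    intro M
    induction M with
    | zero => simp
    | succ M ih =>
      rw [show τ N - τ (N + (M + 1)) = (τ N - τ (N + M)) + (τ (N + M) - τ (N + M + 1)) by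
        rw [← add_assoc]; ring]
      refine v.map_add_le ih ((hC (N + M)).trans ?_)
      rw [exp_le_exp]
      have : (q : ℤ) ^ N ≤ (q : ℤ) ^ (N + M) :=
        pow_le_pow_right₀ (by exact_mod_cast hq) (Nat.le_add_right _ _)
      linarith
  obtain ⟨N₀, hN₀⟩ := hτ (-1 * (q : ℤ) ^ N + C)
  have := v.map_add_le (key N₀) (hN₀ (N + N₀) (Nat.le_add_left _ _))
  rwa [sub_add_cancel] at this

lemma IsBigO.shift_iterate {y : ℕ → K} {e : ℤ} (h : IsBigO v q y e) (i : ℕ) :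
    IsBigO v q (fun N => y (N + i)) (e * (q : ℤ) ^ i) := by
  obtain ⟨C, hC⟩ := h
  refine ⟨C, fun N => (hC (N + i)).trans (le_of_eq ?_)⟩
  rw [pow_add]
  ring_nf

lemma IsBigO.pow {y : ℕ → K} {e : ℤ} (h : IsBigO v q y e) (s : ℕ) :
    IsBigO v q (y ^ s) (s * e) := by
  induction s with
  | zero =>
    rw [pow_zero, Nat.cast_zero, zero_mul]
    exact IsBigO.const (v := v) (q := q) (1 : K)
  | succ s ih =>
    rw [pow_succ]
    exact (ih.mul h).mono (by push_cast; linarith)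

lemma map_carlitzL_succ {t : k} (ht : φ t = T) (N : ℕ) : φ (carlitzL t q (N + 1)) =
    φ (carlitzL t q N) * (T - T ^ q ^ (N + 1)) := by
  rw [carlitzL_succ, map_mul, map_sub, map_pow, ht]

lemma valuation_carlitzL {t : k} (ht : φ t = T) (hT : v T = exp 1) (hq : 2 ≤ q) (N : ℕ) :
    v (φ (carlitzL t q N)) = exp (∑ i ∈ Finset.range N, (q : ℤ) ^ (i + 1)) := by
  induction N with
  | zero => simp [carlitzL]
  | succ N ih =>
    rw [map_carlitzL_succ ht, map_mul, ih, valuation_sub_pow hT hq, ← exp_add,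
      Finset.sum_range_succ]

lemma isBigO_carlitzL {t : k} (ht : φ t = T) (hT : v T = exp 1) (hq : 2 ≤ q) :
    IsBigO v q (fun N => φ (carlitzL t q N)) 2 := by
  refine ⟨0, fun N => ?_⟩
  rw [valuation_carlitzL ht hT hq, exp_le_exp, add_zero]
  induction N with
  | zero => simp
  | succ N ih =>
    rw [Finset.sum_range_succ, pow_succ]
    have : (0 : ℤ) < (q : ℤ) ^ N := by positivity
    have h2 : (2 : ℤ) ≤ q := by exact_mod_cast hq
    nlinarith

lemma hasExpansion_carlitzL_pow_mul {t : k} (ht : φ t = T) (hT : v T = exp 1) (hq : 2 ≤ q) {s : ℕ}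
    {τ A : ℕ → K} (hτ : IsBigO v q τ (-1)) (hA : HasExpansion φ v T q A)
    (h : ∀ N, φ (carlitzL t q N) ^ s * (τ N - τ (N + 1)) = A N) :
    HasExpansion φ v T q (fun N => φ (carlitzL t q N) ^ s * τ N) := by
  have key : ∀ I : ℕ, ∃ z, HasExpansion φ v T q z ∧
      ∀ N, φ (carlitzL t q N) ^ s * τ N - z N = φ (carlitzL t q N) ^ s * τ (N + I) := by
    intro I
    induction I with
    | zero => exact ⟨_, HasExpansion.evalSeq 0, fun N => by simp⟩
    | succ I ih =>
      obtain ⟨z, hz, hz'⟩ := ih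
      refine ⟨_, hA.add hT (((hasExpansion_inv_sub hT hq ht).pow hT s).mul hT
        (hz.shift (by omega))), fun N => ?_⟩
      have h1 := hz' (N + 1)
      rw [map_carlitzL_succ ht] at h1
      have h2 := sub_pow_ne_zero hT hq N
      simp only [Pi.add_apply, Pi.mul_apply, Pi.pow_apply]
      rw [← h N, inv_pow, show N + (I + 1) = N + 1 + I by ring]
      rw [mul_pow] at h1
      field_simp
      linear_combination h1
  refine HasExpansion.of_approx fun m => ?_
  obtain ⟨z, hz, hz'⟩ := key (m + 2 * s)
  refine ⟨z, hz, ?_⟩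
  have h1 : (fun N => φ (carlitzL t q N) ^ s * τ N) - z =
      (fun N => φ (carlitzL t q N)) ^ s * fun N => τ (N + (m + 2 * s)) := funext hz'
  rw [h1]
  refine (((isBigO_carlitzL ht hT hq).pow s).mul (hτ.shift_iterate (m + 2 * s))).mono ?_
  have h2 : ((m + 2 * s : ℕ) : ℤ) < (q : ℤ) ^ (m + 2 * s) := by
    exact_mod_cast Nat.lt_pow_self (by omega)
  push_cast at h2
  linarith

lemma HasBoundedDenom.of_recurrence {A : Subring k} {t : k} (htA : t ∈ A) {e : ℕ} {x y : ℕ → k}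
    (hx0 : x 0 = 0) (hy : HasBoundedDenom A y)
    (h : ∀ N, x (N + 1) = (t - t ^ q ^ (N + 1)) ^ e * (x N + y N)) : HasBoundedDenom A x := by
  obtain ⟨δ, hδ, h0, hδy⟩ := hy
  refine ⟨δ, hδ, h0, fun N => ?_⟩
  induction N with
  | zero => simp [hx0]
  | succ N ih =>
    rw [h, mul_left_comm, mul_add]
    exact A.mul_mem (A.pow_mem (A.sub_mem htA (A.pow_mem htA _)) _) (A.add_mem ih (hδy N))

lemma valuation_sum_range_eq_one {S : ℕ → k} (h0 : S 0 = 1) (h : ∀ d, v (φ (S (d + 1))) < 1)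
    (N : ℕ) : v (φ (∑ d ∈ Finset.range (N + 1), S d)) = 1 := by
  induction N with
  | zero => simp [h0]
  | succ N ih =>
    rw [Finset.sum_range_succ, map_add, Valuation.map_add_eq_of_lt_left, ih]
    rw [ih]
    exact h N

lemma coeff_eq_zero_of_zeta_relation {A : Subring k} {t : k} (ht : φ t = T) (htA : t ∈ A)
    (hA : ∀ x : k, ∃ δ ∈ A, δ ≠ 0 ∧ δ * x ∈ A) (hAv : ∀ x ∈ A, v (φ x) < 1 → x = 0)
    (hT : v T = exp 1) (hq : 2 ≤ q) {n : ℕ} {J : Finset ℕ} (hJ : ∀ j ∈ J, j ≠ 0 ∧ j < n)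
    {c : ℕ → k} {S : ℕ → ℕ → k} {α : ℕ → k[X]}
    (hS : ∀ s, s ≠ 0 → ∀ d, S s d * carlitzL t q d ^ s = (α s).eval (t ^ q ^ d))
    (hSO : ∀ s, s ≠ 0 → IsBigO v q (fun d => φ (S s d)) (-1))
    (hS0 : ∀ s, S s 0 = 1) (hS1 : ∀ s, s ≠ 0 → ∀ d, v (φ (S s (d + 1))) < 1)
    {ζ : ℕ → K}
    (hζ : ∀ s, s ≠ 0 → TendsToZero v (fun N => ζ s - φ (∑ d ∈ Finset.range N, S s d)))
    {Z : ℕ → K} (hZ : ∀ j ∈ J, TendsToZero v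
      (fun N => Z j - φ (∑ d ∈ Finset.range N, S (n - j) d * ∑ e ∈ Finset.range d, S j e)))
    {P : K} (hP : HasExpansion φ v T q (fun N => φ (carlitzL t q N) ^ n * P))
    (hrel : ∑ j ∈ J, φ (c j) * Z j + P = 0) : ∀ j ∈ J, ¬ (q - 1) ∣ j → c j = 0 := by
  set Λ : ℕ → K := fun N => φ (carlitzL t q N) with hΛ
  set σ : ℕ → ℕ → k := fun s N => ∑ d ∈ Finset.range N, S s d with hσ
  set τ : ℕ → ℕ → K := fun s N => ζ s - φ (σ s N) with hτ
  set Y : ℕ → ℕ → k := fun j N => ∑ d ∈ Finset.range N, S (n - j) d * σ j d with hY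
  set ρ : ℕ → ℕ → K := fun j N => Z j - φ (Y j N) - φ (σ j N) * τ (n - j) N with hρ
  have hσ' : ∀ s N, σ s (N + 1) = σ s N + S s N := fun s N => Finset.sum_range_succ _ _
  have hY' : ∀ j N, Y j (N + 1) = Y j N + S (n - j) N * σ j N := fun j N =>
    Finset.sum_range_succ _ _
  have hΛ' : ∀ N, Λ (N + 1) = Λ N * (T - T ^ q ^ (N + 1)) := map_carlitzL_succ ht
  have hτ' : ∀ s N, τ s N - τ s (N + 1) = φ (S s N) := fun s N => by
    simp only [hτ, hσ', map_add]
    ring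
  have hρ' : ∀ j N, ρ j N - ρ j (N + 1) = φ (S j N) * τ (n - j) (N + 1) := fun j N => by
    have := hτ' (n - j) N
    simp only [hρ, hσ', hY', map_add, map_mul]
    linear_combination (-φ (σ j N)) * this
  have hS' : ∀ s, s ≠ 0 → ∀ N, Λ N ^ s * φ (S s N) = evalSeq φ T q (α s) N := fun s hs N => by
    rw [evalSeq_eq_map_eval ht, ← hS s hs, map_mul, map_pow, mul_comm]
  have hD : ∀ e N, evalSeq φ T q (frobDiff t q ^ e) N = (T - T ^ q ^ (N + 1)) ^ e := fun e N => by
    rw [map_pow, Pi.pow_apply, evalSeq_frobDiff ht]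
  have hσ1 : ∀ s, s ≠ 0 → ∀ N, v (φ (σ s N)) ≤ 1 := by
    intro s hs N
    cases N with
    | zero => simp [hσ]
    | succ N => exact (valuation_sum_range_eq_one (hS0 s) (hS1 s hs) N).le
  have hτO : ∀ s, s ≠ 0 → IsBigO v q (τ s) (-1) := fun s hs =>
    TendsToZero.isBigO (τ := τ s) (hζ s hs) (by omega) (by simpa only [hτ'] using hSO s hs)
  have hζ1 : ∀ s, s ≠ 0 → ζ s ≠ 0 := by
    rintro s hs h0
    obtain ⟨N₀, hN₀⟩ := hζ s hs (-1)
    have h1 := hN₀ (N₀ + 1) (by omega)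
    beta_reduce at h1
    rw [h0, zero_sub, Valuation.map_neg, valuation_sum_range_eq_one (hS0 s) (hS1 s hs),
      ← exp_zero, exp_le_exp] at h1
    omega
  have hfe : ∀ s, s ≠ 0 → HasExpansion φ v T q (fun N => Λ N ^ s * τ s N) := fun s hs =>
    hasExpansion_carlitzL_pow_mul ht hT hq (hτO s hs) (HasExpansion.evalSeq (α s)) fun N => by
      rw [hτ', ← hS' s hs]
  have hρO : ∀ j ∈ J, IsBigO v q (ρ j) (-1) := by
    intro j hj
    obtain ⟨hj0, hjn⟩ := hJ j hj
    have hnj : n - j ≠ 0 := by omega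
    refine TendsToZero.isBigO ((hZ j hj).sub ((hζ _ hnj).mul_of_le_one (hσ1 j hj0)))
      (by omega) ?_
    refine IsBigO.mono (e := -1 + -1 * q) ?_ (by omega)
    simp only [hρ']
    exact (hSO j hj0).mul (hτO _ hnj).shift
  have hsplit : ∀ j ∈ J, ∀ x : K, x ^ n = x ^ (n - j) * x ^ j := fun j hj x => by
    rw [← pow_add, Nat.sub_add_cancel (hJ j hj).2.le]
  have hGe : ∀ j ∈ J, HasExpansion φ v T q (fun N => Λ N ^ n * ρ j N) := by
    intro j hj
    obtain ⟨hj0, hjn⟩ := hJ j hj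
    have hnj : n - j ≠ 0 := by omega
    refine hasExpansion_carlitzL_pow_mul ht hT hq (hρO j hj)
      (HasExpansion.mul_evalSeq hT (α j) ((hfe _ hnj).sub hT
        (HasExpansion.evalSeq (α (n - j))))) fun N => ?_
    have h1 := hτ' (n - j) N
    simp only [Pi.mul_apply, Pi.sub_apply, ← hS' j hj0, ← hS' _ hnj]
    rw [hρ', hsplit j hj]
    linear_combination -Λ N ^ (n - j) * Λ N ^ j * φ (S j N) * h1
  have hsden : ∀ j ∈ J, HasBoundedDenom A (fun N => carlitzL t q N ^ j * σ j N) := by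
    intro j hj
    refine HasBoundedDenom.of_recurrence (q := q) (e := j) htA (by simp [hσ])
      (HasBoundedDenom.eval hA (α j) fun N => A.pow_mem htA (q ^ N)) fun N => ?_
    rw [← hS j (hJ j hj).1, hσ', carlitzL_succ, mul_pow]
    ring
  have hYden : ∀ j ∈ J, HasBoundedDenom A (fun N => carlitzL t q N ^ n * Y j N) := by
    intro j hj
    obtain ⟨hj0, hjn⟩ := hJ j hj
    refine HasBoundedDenom.of_recurrence (q := q) (e := n) htA (by simp [hY])
      ((HasBoundedDenom.eval hA (α (n - j)) fun N => A.pow_mem htA (q ^ N)).mul (hsden j hj))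
      fun N => ?_
    simp only [Pi.mul_apply]
    rw [← hS (n - j) (by omega), hY', carlitzL_succ, mul_pow]
    have : carlitzL t q N ^ n = carlitzL t q N ^ (n - j) * carlitzL t q N ^ j := by
      rw [← pow_add, Nat.sub_add_cancel hjn.le]
    rw [this]
    ring
  refine coeff_eq_zero_of_relation (φ := φ) (v := v) (α := α) (κ := n * 2)
    (f := fun s N => Λ N ^ s * τ s N)
    (g := fun N => ∑ j ∈ J, φ (c j) * (Λ N ^ n * ρ j N) + Λ N ^ n * P)
    (a := fun N => ∑ j ∈ J, c j * (carlitzL t q N ^ n * Y j N))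
    (b := fun j N => c j * (carlitzL t q N ^ j * σ j N))
    ht htA hA hAv hT hq hJ hfe ?_ ?_ ?_ ?_ ?_ ?_ ?_ ?_
  · intro s hs
    simpa [hΛ, hτ, hσ, carlitzL] using hζ1 s hs
  · intro s hs N
    have h1 := hτ' s N
    simp only [hD, ← hS' s hs, hΛ', mul_pow]
    rw [← h1]
    ring
  · refine HasExpansion.add hT ?_ hP
    have : (fun N => ∑ j ∈ J, φ (c j) * (Λ N ^ n * ρ j N)) =
        ∑ j ∈ J, evalSeq φ T q (C (c j)) * fun N => Λ N ^ n * ρ j N := by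
      funext N
      simp
    rw [this]
    exact HasExpansion.sum hT _ fun j hj => (hGe j hj).mul_evalSeq hT _
  · intro N
    simp only [hD, map_mul, Pi.mul_apply, evalSeq_C, hΛ']
    rw [mul_add, Finset.mul_sum, add_right_comm, ← Finset.sum_add_distrib]
    congr 1
    · refine Finset.sum_congr rfl fun j hj => ?_
      have h1 := hρ' j N
      rw [← hS' j (hJ j hj).1, mul_pow, mul_pow, hsplit j hj, hsplit j hj]
      linear_combination φ (c j) * (T - T ^ q ^ (N + 1)) ^ (n - j) * (T - T ^ q ^ (N + 1)) ^ j *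
        Λ N ^ (n - j) * Λ N ^ j * h1
    · rw [mul_pow]
      ring
  · convert HasBoundedDenom.sum (A := A) J (f := fun j => (fun _ => c j) *
      fun N => carlitzL t q N ^ n * Y j N) fun j hj =>
        (HasBoundedDenom.const hA _).mul (hYden j hj) using 1
    funext N
    simp
  · exact fun j hj => (HasBoundedDenom.const hA (c j)).mul (hsden j hj)
  · intro j hj
    obtain ⟨hj0, hjn⟩ := hJ j hj
    have h1 : IsBigO v q (fun N => φ (σ j N)) 0 :=
      ⟨0, fun N => by simpa using hσ1 j hj0 N⟩
    have h2 := (IsBigO.const (v := v) (q := q) (φ (c j))).mul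
      (((isBigO_carlitzL ht hT hq).pow j).mul h1)
    simp only [map_mul, map_pow]
    refine h2.mono ?_
    have : (j : ℤ) ≤ n := by exact_mod_cast hjn.le
    push_cast
    linarith
  · intro N
    have h1 := congrArg (Λ N ^ n * ·) hrel
    simp only [mul_zero, mul_add, Finset.mul_sum] at h1
    rw [← h1, ← add_assoc, map_sum, ← Finset.sum_add_distrib, ← Finset.sum_add_distrib]
    congr 1
    refine Finset.sum_congr rfl fun j hj => ?_
    simp only [map_mul, map_pow, hρ]
    rw [show φ (carlitzL t q N) = Λ N from rfl, hsplit j hj]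
    ring

end Tails

section Valued

open WithZero Filter Topology

variable {K : Type*} [Field K] [Valued K ℤᵐ⁰]

lemma tendsto_nhds_iff_valuation {T : K} (hT : Valued.v T = exp 1) {ι : Type*} {l : Filter ι}
    {y : ι → K} {z : K} :
    Tendsto y l (𝓝 z) ↔ ∀ C : ℤ, ∀ᶠ i in l, Valued.v (y i - z) ≤ exp C := by
  constructor
  · intro h C
    refine h.eventually (p := fun x => Valued.v (x - z) ≤ exp C) (Valued.mem_nhds.2 ?_)
    have h0 : (Valued.v : Valuation K ℤᵐ⁰).restrict (T ^ C) ≠ 0 := by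
      rw [Ne, Valuation.restrict_eq_zero_iff, map_zpow₀, hT]
      exact zpow_ne_zero _ exp_ne_zero
    refine ⟨Units.mk0 _ h0, fun y hy => ?_⟩
    have h1 : Valued.v (y - z) < Valued.v (T ^ C) := (Valuation.restrict_lt_iff _).1 hy
    rw [map_zpow₀, hT, ← exp_zsmul] at h1
    simpa using h1.le
  · rw [Filter.tendsto_def]
    intro h s hs
    obtain ⟨γ, hγ⟩ := Valued.mem_nhds.1 hs
    have h0 : MonoidWithZeroHom.ValueGroup₀.embedding γ.1 ≠ 0 := by simp
    filter_upwards [h (log (MonoidWithZeroHom.ValueGroup₀.embedding γ.1) - 1)] with i hi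
    refine hγ ?_
    change Valued.v.restrict (y i - z) < γ.1
    rw [Valuation.restrict_lt_iff_lt_embedding]
    refine hi.trans_lt ?_
    conv_rhs => rw [← exp_log h0]
    rw [exp_lt_exp]
    omega

lemma tendsToZero_sub_iff {T : K} (hT : Valued.v T = exp 1) {y : ℕ → K} {z : K} :
    TendsToZero Valued.v (fun N => z - y N) ↔ Tendsto y atTop (𝓝 z) := by
  rw [tendsto_nhds_iff_valuation hT]
  simp only [TendsToZero, eventually_atTop, Valuation.map_sub_swap _ z]

lemma summable_of_forall_finite [CompleteSpace K] {T : K} (hT : Valued.v T = exp 1) {ι : Type*}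
    {f : ι → K} (h : ∀ C : ℤ, {i | ¬ Valued.v (f i) ≤ exp C}.Finite) : Summable f := by
  have : NonarchimedeanRing K := (Valued.toUniformSpace_eq K ℤᵐ⁰).symm ▸
    (Valued.v : Valuation K ℤᵐ⁰).subgroups_basis.nonarchimedean
  refine NonarchimedeanAddGroup.summable_of_tendsto_cofinite_zero ?_
  rw [tendsto_nhds_iff_valuation hT]
  intro C
  simpa [eventually_cofinite] using h C

lemma exists_tendsToZero_sub_sum [CompleteSpace K] {T : K} (hT : Valued.v T = exp 1) {a : ℕ → K}
    (ha : TendsToZero Valued.v a) :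
    ∃ z, TendsToZero Valued.v (fun N => z - ∑ d ∈ Finset.range N, a d) := by
  have h : Summable a := by
    refine summable_of_forall_finite hT fun C => ?_
    obtain ⟨N₀, hN₀⟩ := ha C
    refine (Finset.finite_toSet (Finset.range N₀)).subset fun d hd => ?_
    rw [Finset.mem_coe, Finset.mem_range]
    by_contra! h
    exact hd (hN₀ d h)
  exact ⟨_, (tendsToZero_sub_iff hT).2 h.hasSum.tendsto_sum_nat⟩

end Valued

section Product

open WithZero Filter Topology

lemma valuation_prod_sub_one_le {K : Type*} [Field K] {v : Valuation K ℤᵐ⁰} {ι : Type*}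
    {s : Finset ι} {f : ι → K} {γ : ℤᵐ⁰} (hγ : γ ≤ 1) (h : ∀ i ∈ s, v (f i - 1) ≤ γ) :
    v (∏ i ∈ s, f i - 1) ≤ γ := by
  classical
  induction s using Finset.induction_on with
  | empty => simp
  | insert a s ha ih =>
    rw [Finset.prod_insert ha, show f a * ∏ i ∈ s, f i - 1 =
      (f a - 1) * ∏ i ∈ s, f i + (∏ i ∈ s, f i - 1) by ring]
    have h1 := ih fun i hi => h i (Finset.mem_insert_of_mem hi)
    refine v.map_add_le ?_ h1
    rw [map_mul]
    have h2 : v (∏ i ∈ s, f i) ≤ 1 := by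
      have := v.map_add_le (h1.trans hγ) (map_one v).le
      rwa [sub_add_cancel] at this
    exact (mul_le_of_le_one_right' h2).trans (h a (Finset.mem_insert_self _ _))

variable {K : Type*} [Field K] [Valued K ℤᵐ⁰] [CompleteSpace K]

/-- The error made by truncating an infinite product is bounded by the first omitted factor. -/
lemma valuation_tprod_sub_prod_le {T : K} (hT : Valued.v T = exp 1) {f : ℕ → K} {e : ℕ → ℤ}
    (he : Antitone e) (he0 : ∀ i, e i ≤ 0) (he1 : ∀ C, ∃ i, e i ≤ C)
    (hf : ∀ i, Valued.v (f i - 1) ≤ exp (e i)) (N : ℕ) :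
    Valued.v (∏' i, f i - ∏ i ∈ Finset.range N, f i) ≤ exp (e N) := by
  have hexp : ∀ i, exp (e i) ≤ 1 := fun i => by
    rw [← exp_zero, exp_le_exp]
    exact he0 i
  have hprod : ∀ s : Finset ℕ, Valued.v (∏ i ∈ s, f i) ≤ 1 := fun s => by
    have h1 : Valued.v (∏ i ∈ s, f i - 1) ≤ 1 :=
      valuation_prod_sub_one_le le_rfl fun i _ => (hf i).trans (hexp i)
    have := Valuation.map_add_le _ h1 (map_one (Valued.v : Valuation K ℤᵐ⁰)).le
    rwa [sub_add_cancel] at this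
  have key : ∀ (N : ℕ) (s : Finset ℕ), Finset.range N ⊆ s →
      Valued.v (∏ i ∈ s, f i - ∏ i ∈ Finset.range N, f i) ≤ exp (e N) := by
    intro N s hs
    rw [← Finset.prod_sdiff hs, ← sub_one_mul, map_mul]
    refine (mul_le_of_le_one_right' (hprod _)).trans
      (valuation_prod_sub_one_le (hexp N) fun i hi => (hf i).trans ?_)
    rw [exp_le_exp]
    exact he (by simpa using (Finset.mem_sdiff.1 hi).2)
  have h1 : TendsToZero Valued.v
      (fun N => ∏ i ∈ Finset.range (N + 1), f i - ∏ i ∈ Finset.range N, f i) := fun C => by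
    obtain ⟨i, hi⟩ := he1 C
    refine ⟨i, fun N hN => (key N _ (by simp)).trans ?_⟩
    rw [exp_le_exp]
    exact (he hN).trans hi
  obtain ⟨z, hz⟩ := exists_tendsToZero_sub_sum hT h1
  simp only [Finset.sum_range_sub (fun N => ∏ i ∈ Finset.range N, f i),
    Finset.prod_range_zero] at hz
  have h2 : HasProd f (z + 1) := by
    rw [HasProd, SummationFilter.unconditional_filter, tendsto_nhds_iff_valuation hT]
    intro C
    obtain ⟨i, hi⟩ := he1 C
    obtain ⟨N₀, hN₀⟩ := hz C
    filter_upwards [eventually_ge_atTop (Finset.range (max i N₀))] with s hs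
    have h3 := (key _ s hs).trans (exp_le_exp.2 ((he (le_max_left i N₀)).trans hi))
    have h4 := Valuation.map_sub_le _ h3 (hN₀ _ (le_max_right i N₀))
    convert h4 using 2
    ring
  rw [h2.tprod_eq]
  obtain ⟨N₀, hN₀⟩ := hz (e N)
  have h3 := key N (Finset.range (N + N₀)) (by simp)
  have h4 := Valuation.map_add_le _ h3 (hN₀ (N + N₀) (by omega))
  convert h4 using 2
  ring

end Product

section Period

open WithZero

variable {k K : Type*} [Field k] [Field K] {v : Valuation K ℤᵐ⁰} {q : ℕ} {φ : k →+* K} {T : K}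

lemma isBigO_of_mul_carlitzL_pow {t : k} (ht : φ t = T) (hT : v T = exp 1) (hq : 2 ≤ q) {s : ℕ}
    (hs : s ≠ 0) {S : ℕ → k} {α : k[X]}
    (hS : ∀ d, S d * carlitzL t q d ^ s = α.eval (t ^ q ^ d))
    (hα : (q - 1) * α.natDegree ≤ q * (s - 1)) :
    IsBigO v q (fun d => φ (S d)) (-1) := by
  obtain ⟨C, hC⟩ := isBigO_evalSeq (φ := φ) (q := q) hT α le_rfl
  refine ⟨C + s * q, fun d => ?_⟩
  have h1 := hC d
  rw [evalSeq_eq_map_eval ht, ← hS, map_mul, map_mul, map_pow, map_pow,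
    valuation_carlitzL ht hT hq, ← exp_nsmul] at h1
  set σ : ℤ := ∑ i ∈ Finset.range d, (q : ℤ) ^ (i + 1) with hσ
  have h2 : ((q : ℤ) - 1) * σ = q ^ (d + 1) - q := by
    have := geom_sum_mul (q : ℤ) d
    rw [hσ]
    simp only [pow_succ, ← Finset.sum_mul]
    linear_combination (q : ℤ) * this
  have h3 : v (φ (S d)) ≤ exp (α.natDegree * (q : ℤ) ^ d + C - s * σ) := by
    have h4 := mul_le_mul_left h1 (exp (-(s • σ)))
    rw [mul_assoc, ← exp_add, ← exp_add, add_neg_cancel, exp_zero, mul_one] at h4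
    simpa [sub_eq_add_neg] using h4
  refine h3.trans (exp_le_exp.2 ?_)
  have hq' : (2 : ℤ) ≤ q := by exact_mod_cast hq
  have hα' : ((q : ℤ) - 1) * α.natDegree ≤ q * (s - 1) := by
    zify [show 1 ≤ q by omega, Nat.one_le_iff_ne_zero.2 hs] at hα
    exact hα
  have hpos : (0 : ℤ) < (q : ℤ) ^ d := by positivity
  have hs' : (0 : ℤ) ≤ s * q := by positivity
  refine le_of_mul_le_mul_left ?_ (show (0 : ℤ) < q - 1 by linarith)
  rw [pow_succ] at h2
  have h5 := mul_le_mul_of_nonneg_right hα' hpos.le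
  have h6 : (s : ℤ) * ((q - 1) * σ) = s * (q ^ d * q - q) := by rw [h2]
  nlinarith

lemma HasExpansion.of_multiplicative_recurrence (hT : v T = exp 1) (hq : 2 ≤ q) {F u : ℕ → K}
    (hF : HasExpansion φ v T q F) (hF1 : ∀ N, v (F N) ≤ 1) (h : ∀ N, u N = F N * u (N + 1))
    (hu : IsBigO v q (fun N => u N - 1) (-1)) : HasExpansion φ v T q u := by
  have key : ∀ I : ℕ, ∃ z, HasExpansion φ v T q z ∧
      ∀ N, v (z N) ≤ 1 ∧ u N = z N * u (N + I) := by
    intro I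
    induction I with
    | zero => exact ⟨_, HasExpansion.evalSeq 1, fun N => by simp⟩
    | succ I ih =>
      obtain ⟨z, hz, hz'⟩ := ih
      refine ⟨_, hF.mul hT (hz.shift (by omega)), fun N => ⟨?_, ?_⟩⟩
      · rw [Pi.mul_apply, map_mul]
        exact mul_le_one' (hF1 N) (hz' (N + 1)).1
      · rw [h N, (hz' (N + 1)).2, Pi.mul_apply, mul_assoc, show N + (I + 1) = N + 1 + I by ring]
  refine HasExpansion.of_approx fun m => ?_
  obtain ⟨z, hz, hz'⟩ := key m
  refine ⟨z, hz, ?_⟩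
  have h1 : u - z = z * fun N => u (N + m) - 1 := funext fun N => by
    rw [Pi.sub_apply, Pi.mul_apply, mul_sub, ← (hz' N).2, mul_one]
  have h2 : IsBigO v q z 0 := ⟨0, fun N => by simpa using (hz' N).1⟩
  rw [h1]
  refine (h2.mul (hu.shift_iterate m)).mono ?_
  have h3 : (m : ℤ) < (q : ℤ) ^ m := by exact_mod_cast Nat.lt_pow_self (by omega)
  linarith

/-- The factors of the product formula for the `(q - 1)`-st power of the Carlitz period. -/
noncomputable def periodFactor (T : K) (q i : ℕ) : K :=
  ((1 - T ^ ((1 : ℤ) - (q : ℤ) ^ (i + 1)))⁻¹) ^ (q - 1)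

lemma periodFactor_eq (hT : v T = exp 1) (i : ℕ) :
    periodFactor T q i = (-(T ^ q ^ (i + 1)) * (T - T ^ q ^ (i + 1))⁻¹) ^ (q - 1) := by
  have hT0 : T ≠ 0 := by
    rintro rfl
    rw [map_zero] at hT
    exact exp_ne_zero hT.symm
  rw [periodFactor, zpow_sub₀ hT0, zpow_one, ← Nat.cast_pow, zpow_natCast,
    one_sub_div (pow_ne_zero _ hT0), inv_div, ← neg_sub T, div_neg, neg_mul, div_eq_mul_inv]

lemma valuation_periodFactor_sub_one_le (hT : v T = exp 1) (hq : 2 ≤ q) (i : ℕ) :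
    v (periodFactor T q i - 1) ≤ exp (1 - (q : ℤ) ^ (i + 1)) := by
  have h1 : (1 : ℤ) ≤ (q : ℤ) ^ (i + 1) := by exact_mod_cast Nat.one_le_pow _ _ (by omega)
  have hD := sub_pow_ne_zero hT hq i
  have h2 : v (-(T ^ q ^ (i + 1)) * (T - T ^ q ^ (i + 1))⁻¹ - 1) =
      exp (1 - (q : ℤ) ^ (i + 1)) := by
    rw [show -(T ^ q ^ (i + 1)) * (T - T ^ q ^ (i + 1))⁻¹ - 1 = -(T * (T - T ^ q ^ (i + 1))⁻¹) by
      field_simp; ring, Valuation.map_neg, map_mul, map_inv₀, valuation_sub_pow hT hq, hT,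
      ← exp_neg, ← exp_add, sub_eq_add_neg]
  rw [periodFactor_eq hT, ← Finset.card_range (q - 1), ← Finset.prod_const]
  refine valuation_prod_sub_one_le ?_ fun _ _ => h2.le
  rw [← exp_zero, exp_le_exp]
  linarith

lemma valuation_prod_periodFactor (hT : v T = exp 1) (hq : 2 ≤ q) (s : Finset ℕ) :
    v (∏ i ∈ s, periodFactor T q i) = 1 := by
  rw [map_prod]
  refine Finset.prod_eq_one fun i _ => ?_
  have h := (valuation_periodFactor_sub_one_le hT hq i).trans_lt (c := 1) (by
    rw [← exp_zero, exp_lt_exp, sub_neg]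
    exact_mod_cast Nat.one_lt_pow (by omega) (by omega))
  simpa using Valuation.map_one_add_of_lt _ h

lemma hasExpansion_periodFactor {t : k} (ht : φ t = T) (hT : v T = exp 1) (hq : 2 ≤ q) :
    HasExpansion φ v T q (periodFactor T q) := by
  have h : periodFactor T q =
      (evalSeq φ T q (-X ^ q) * fun N => (T - T ^ q ^ (N + 1))⁻¹) ^ (q - 1) := funext fun N => by
    rw [periodFactor_eq hT]
    simp [pow_succ q N, pow_mul]
  rw [h]
  exact ((hasExpansion_inv_sub hT hq ht).mul_evalSeq hT _).pow hT _

lemma carlitzL_pow_mul_prod_periodFactor {t : k} (ht : φ t = T) (hT : v T = exp 1) (hq : 2 ≤ q)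
    (hneg : (-1 : K) ^ (q - 1) = 1) (N : ℕ) :
    φ (carlitzL t q N) ^ (q - 1) * (∏ i ∈ Finset.range N, periodFactor T q i) * T ^ q =
      T ^ q ^ (N + 1) := by
  induction N with
  | zero => simp [carlitzL]
  | succ N ih =>
    have hD := sub_pow_ne_zero hT hq N
    rw [map_carlitzL_succ ht, Finset.prod_range_succ, periodFactor_eq hT, pow_succ q (N + 1),
      pow_mul, ← mul_pow_sub_one (show q ≠ 0 by omega) (T ^ q ^ (N + 1))]
    rw [mul_pow, mul_pow, neg_pow, hneg, one_mul, inv_pow]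
    have h := pow_ne_zero (q - 1) hD
    field_simp
    linear_combination (T ^ q ^ (N + 1)) ^ (q - 1) * ih

end Period

section Period

open WithZero

variable {k K : Type*} [Field k] [Field K] [Valued K ℤᵐ⁰] [CompleteSpace K] {q : ℕ} {φ : k →+* K}
  {T : K}

lemma valuation_tprod_periodFactor_sub_prod_le (hT : Valued.v T = exp 1) (hq : 2 ≤ q) (N : ℕ) :
    Valued.v (∏' i, periodFactor T q i - ∏ i ∈ Finset.range N, periodFactor T q i) ≤
      exp (1 - (q : ℤ) ^ (N + 1)) := by
  have hq' : (1 : ℤ) ≤ q := by exact_mod_cast (by omega : 1 ≤ q)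
  refine valuation_tprod_sub_prod_le (e := fun i => 1 - (q : ℤ) ^ (i + 1)) hT ?_ ?_ ?_
    (valuation_periodFactor_sub_one_le hT hq) N
  · intro i j hij
    exact sub_le_sub_left (pow_le_pow_right₀ hq' (by omega)) _
  · intro i
    have := one_le_pow₀ hq' (n := i + 1)
    simpa using this
  · intro C
    refine ⟨C.natAbs, ?_⟩
    have h : ((C.natAbs + 1 : ℕ) : ℤ) < (q : ℤ) ^ (C.natAbs + 1) := by
      exact_mod_cast Nat.lt_pow_self (by omega)
    push_cast at h
    have := neg_abs_le C
    linarith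

lemma valuation_tprod_periodFactor (hT : Valued.v T = exp 1) (hq : 2 ≤ q) :
    Valued.v (∏' i, periodFactor T q i) = 1 := by
  have h := (valuation_tprod_periodFactor_sub_prod_le hT hq 0).trans_lt (c := 1) (by
    rw [← exp_zero, exp_lt_exp, sub_neg]
    exact_mod_cast Nat.one_lt_pow (by omega) (by omega))
  rw [Finset.prod_range_zero] at h
  simpa using Valuation.map_one_add_of_lt _ h

/-- The `(q - 1)`-st power of the Carlitz period, multiplied by powers of the `ℓ_N`, has an
asymptotic expansion. -/
lemma hasExpansion_carlitzL_pow_mul_period {t : k} (ht : φ t = T) (hT : Valued.v T = exp 1)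
    (hq : 2 ≤ q) (hneg : (-1 : K) ^ (q - 1) = 1) :
    HasExpansion φ Valued.v T q (fun N => φ (carlitzL t q N) ^ (q - 1) *
      (-(T ^ q) * ∏' i, periodFactor T q i)) := by
  set p := ∏' i, periodFactor T q i with hp
  set P : ℕ → K := fun N => ∏ i ∈ Finset.range N, periodFactor T q i with hP
  have hv : ∀ N, Valued.v (P N) = 1 := fun N => valuation_prod_periodFactor hT hq _
  have hP0 : ∀ N, P N ≠ 0 := fun N h => by
    have := hv N
    rw [h, map_zero] at this
    exact zero_ne_one this
  have hPs : ∀ N, P (N + 1) = P N * periodFactor T q N := fun N => Finset.prod_range_succ _ _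
  have hf0 : ∀ N, periodFactor T q N ≠ 0 := fun N => right_ne_zero_of_mul (hPs N ▸ hP0 (N + 1))
  have hu : HasExpansion φ Valued.v T q (fun N => p / P N) := by
    refine (hasExpansion_periodFactor ht hT hq).of_multiplicative_recurrence hT hq
      (fun N => ?_) (fun N => ?_) ⟨1, fun N => ?_⟩
    · simpa using (valuation_prod_periodFactor hT hq {N}).le
    · have h1 := hP0 N
      have h2 := hf0 N
      rw [hPs]
      field_simp
    · change Valued.v (p / P N - 1) ≤ _
      rw [div_sub_one (hP0 N), map_div₀, hv, div_one]
      refine (valuation_tprod_periodFactor_sub_prod_le hT hq N).trans (exp_le_exp.2 ?_)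
      have := pow_le_pow_right₀ (show (1 : ℤ) ≤ q by exact_mod_cast (by omega : 1 ≤ q))
        (show N ≤ N + 1 by omega)
      linarith
  have h : (fun N => φ (carlitzL t q N) ^ (q - 1) * (-(T ^ q) * p)) =
      evalSeq φ T q (-X ^ q) * fun N => p / P N := funext fun N => by
    have h1 := carlitzL_pow_mul_prod_periodFactor ht hT hq hneg N
    have h2 := hP0 N
    simp only [Pi.mul_apply, map_neg, map_pow, Pi.neg_apply, Pi.pow_apply, evalSeq_X, ← pow_mul,
      ← pow_succ]
    rw [← h1]
    change _ = -(φ (carlitzL t q N) ^ (q - 1) * P N * T ^ q) * (p / P N)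
    field_simp
  rw [h]
  exact hu.mul_evalSeq hT _

end Period

section RationalFunctions

variable {Fq : Type*} [Field Fq]

lemma aeval_algebraMap_X (p : Fq[X]) :
    aeval (algebraMap Fq[X] (RatFunc Fq) X) p = algebraMap Fq[X] (RatFunc Fq) p := by
  rw [aeval_algebraMap_apply, aeval_X_left_apply]

lemma transcendental_algebraMap_X : Transcendental Fq (algebraMap Fq[X] (RatFunc Fq) X) := by
  rw [transcendental_iff]
  intro p hp
  rw [aeval_algebraMap_X] at hp
  exact (map_eq_zero_iff _ (RatFunc.algebraMap_injective Fq)).1 hp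

lemma exists_mul_mem_range_algebraMap (x : RatFunc Fq) :
    ∃ δ ∈ (algebraMap Fq[X] (RatFunc Fq)).range, δ ≠ 0 ∧
      δ * x ∈ (algebraMap Fq[X] (RatFunc Fq)).range := by
  have h := RatFunc.algebraMap_ne_zero x.denom_ne_zero
  exact ⟨_, ⟨x.denom, rfl⟩, h, x.num, by
    rw [mul_comm, ← div_eq_iff h, RatFunc.num_div_denom]⟩

variable [Fintype Fq]

lemma monicFinset_zero : monicFinset Fq 0 = {1} := by
  ext p
  rw [mem_monicFinset, Finset.mem_singleton]
  refine ⟨fun h => h.1.natDegree_eq_zero.1 h.2, ?_⟩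
  rintro rfl
  simp

lemma powerSum_zero_left {k : Type*} [Field k] [Algebra Fq k] (t : k) (s : ℕ) :
    powerSum Fq t 0 s = 1 := by
  simp [powerSum, monicFinset_zero]

lemma neg_one_pow_card_sub_one (R : Type*) [Ring R] [Algebra Fq R] :
    (-1 : R) ^ (Fintype.card Fq - 1) = 1 := by
  have h := congrArg (algebraMap Fq R)
    (FiniteField.pow_card_sub_one_eq_one (-1 : Fq) (neg_ne_zero.2 one_ne_zero))
  simpa using h

open Classical in
/-- The pairs of monic polynomials whose degrees satisfy `deg a₂ < deg a₁ < N`. -/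
noncomputable def monicPairs (Fq : Type*) [Field Fq] [Fintype Fq] (N : ℕ) :
    Finset (Fq[X] × Fq[X]) :=
  (Finset.range N).biUnion fun d => (Finset.range d).biUnion fun e =>
    monicFinset Fq d ×ˢ monicFinset Fq e

lemma mem_monicPairs {N : ℕ} {g : Fq[X] × Fq[X]} :
    g ∈ monicPairs Fq N ↔
      (g.1.Monic ∧ g.2.Monic ∧ g.2.degree < g.1.degree) ∧ g.1.natDegree < N := by
  simp only [monicPairs, Finset.mem_biUnion, Finset.mem_range, Finset.mem_product, mem_monicFinset]
  constructor
  · rintro ⟨d, hd, e, he, ⟨h1, rfl⟩, h2, rfl⟩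
    exact ⟨⟨h1, h2, degree_lt_degree he⟩, hd⟩
  · rintro ⟨⟨h1, h2, h3⟩, h4⟩
    exact ⟨_, h4, _, natDegree_lt_natDegree h2.ne_zero h3, ⟨h1, rfl⟩, h2, rfl⟩

lemma sum_monicPairs {M : Type*} [AddCommMonoid M] (N : ℕ)
    (f : Fq[X] × Fq[X] → M) : ∑ g ∈ monicPairs Fq N, f g =
      ∑ d ∈ Finset.range N, ∑ e ∈ Finset.range d, ∑ a ∈ monicFinset Fq d, ∑ b ∈ monicFinset Fq e,
        f (a, b) := by
  classical
  rw [monicPairs, Finset.sum_biUnion]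
  · refine Finset.sum_congr rfl fun d _ => ?_
    rw [Finset.sum_biUnion]
    · exact Finset.sum_congr rfl fun e _ => Finset.sum_product _ _ _
    · intro e _ e' _ hne
      refine Finset.disjoint_left.2 fun g hg hg' => hne ?_
      simp only [Finset.mem_product, mem_monicFinset] at hg hg'
      exact hg.2.2.symm.trans hg'.2.2
  · intro d _ d' _ hne
    refine Finset.disjoint_left.2 fun g hg hg' => hne ?_
    simp only [Finset.mem_biUnion, Finset.mem_product, mem_monicFinset] at hg hg'
    obtain ⟨_, _, ⟨_, h⟩, _⟩ := hg
    obtain ⟨_, _, ⟨_, h'⟩, _⟩ := hg'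
    exact h.symm.trans h'

end RationalFunctions

section Infinity

open WithZero Filter Topology

instance completeSpace_completionAtInfty (Fq : Type) [Field Fq] [DecidableEq (RatFunc Fq)] :
    CompleteSpace (RatFunc.CompletionAtInfty Fq) :=
  letI := RatFunc.inftyValued Fq
  inferInstanceAs (CompleteSpace (UniformSpace.Completion (RatFunc Fq)))

variable {Fq : Type} [Field Fq] [DecidableEq (RatFunc Fq)]

lemma valuation_toKinfty (x : RatFunc Fq) :
    Valued.v (toKinfty Fq x) = RatFunc.inftyValuation Fq x := by
  let _ := RatFunc.inftyValued Fq
  exact Valued.valuedCompletion_apply x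

lemma valuation_toKinfty_algebraMap {p : Fq[X]} (hp : p ≠ 0) :
    Valued.v (toKinfty Fq (algebraMap Fq[X] (RatFunc Fq) p)) = exp (p.natDegree : ℤ) := by
  rw [valuation_toKinfty]
  exact RatFunc.inftyValuation.polynomial Fq hp

lemma valuation_thetaInfty : Valued.v (thetaInfty Fq) = exp 1 := by
  rw [thetaInfty, valuation_toKinfty_algebraMap X_ne_zero, natDegree_X, Nat.cast_one]

lemma eq_zero_of_mem_range_of_valuation_lt_one {x : RatFunc Fq}
    (hx : x ∈ (algebraMap Fq[X] (RatFunc Fq)).range) (h : Valued.v (toKinfty Fq x) < 1) :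
    x = 0 := by
  obtain ⟨p, rfl⟩ := hx
  by_contra hp
  rw [valuation_toKinfty_algebraMap (fun h => hp (by rw [h, map_zero])), ← exp_zero,
    exp_lt_exp] at h
  omega

variable [Fintype Fq]

lemma valuation_toKinfty_inv_pow {d : ℕ} {a : Fq[X]} (ha : a ∈ monicFinset Fq d) (s : ℕ) :
    Valued.v (toKinfty Fq ((algebraMap Fq[X] (RatFunc Fq) a)⁻¹ ^ s)) = exp (-(s * d : ℤ)) := by
  rw [mem_monicFinset] at ha
  rw [map_pow, map_inv₀, map_pow, map_inv₀, valuation_toKinfty_algebraMap ha.1.ne_zero, ha.2,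
    ← exp_neg, ← exp_nsmul]
  simp

lemma valuation_toKinfty_powerSum_le (d : ℕ) {s : ℕ} (hs : s ≠ 0) :
    Valued.v (toKinfty Fq (powerSum Fq (algebraMap Fq[X] (RatFunc Fq) X) d s)) ≤
      exp (-(d : ℤ)) := by
  rw [powerSum, map_sum]
  refine Valuation.map_sum_le _ fun a ha => ?_
  rw [aeval_algebraMap_X, valuation_toKinfty_inv_pow ha, exp_le_exp, neg_le_neg_iff]
  exact_mod_cast Nat.le_mul_of_pos_left d (Nat.pos_of_ne_zero hs)

lemma tendsToZero_powerSum {s : ℕ} (hs : s ≠ 0) : TendsToZero Valued.v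
    (fun d => toKinfty Fq (powerSum Fq (algebraMap Fq[X] (RatFunc Fq) X) d s)) := fun C =>
  ⟨C.natAbs, fun d hd => (valuation_toKinfty_powerSum_le d hs).trans (exp_le_exp.2 (by omega))⟩

lemma valuation_toKinfty_zeta_term_le {a b : Fq[X]} (ha : a.Monic) (hb : b.Monic) {s₁ : ℕ}
    (hs : s₁ ≠ 0) (s₂ : ℕ) :
    Valued.v (toKinfty Fq ((algebraMap Fq[X] (RatFunc Fq) a ^ s₁)⁻¹ *
      (algebraMap Fq[X] (RatFunc Fq) b ^ s₂)⁻¹)) ≤ exp (-(a.natDegree : ℤ)) := by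
  rw [← inv_pow, ← inv_pow, map_mul, map_mul,
    valuation_toKinfty_inv_pow (mem_monicFinset.2 ⟨ha, rfl⟩),
    valuation_toKinfty_inv_pow (mem_monicFinset.2 ⟨hb, rfl⟩), ← exp_add, exp_le_exp]
  have h1 : (a.natDegree : ℤ) ≤ s₁ * a.natDegree := by
    exact_mod_cast Nat.le_mul_of_pos_left _ (Nat.pos_of_ne_zero hs)
  have h2 : (0 : ℤ) ≤ s₂ * b.natDegree := by positivity
  linarith

lemma tendsToZero_doubleZeta_sub {s₁ : ℕ} (hs : s₁ ≠ 0) (s₂ : ℕ) :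
    TendsToZero Valued.v (fun N => doubleZeta Fq s₁ s₂ - toKinfty Fq (∑ d ∈ Finset.range N,
      powerSum Fq (algebraMap Fq[X] (RatFunc Fq) X) d s₁ *
        ∑ e ∈ Finset.range d, powerSum Fq (algebraMap Fq[X] (RatFunc Fq) X) e s₂)) := by
  classical
  have hT := valuation_thetaInfty (Fq := Fq)
  set P : Fq[X] × Fq[X] → Prop := fun g => g.1.Monic ∧ g.2.Monic ∧ g.2.degree < g.1.degree with hP
  set f : Fq[X] × Fq[X] → RatFunc.CompletionAtInfty Fq := fun g =>
    toKinfty Fq ((algebraMap Fq[X] (RatFunc Fq) g.1 ^ s₁)⁻¹ *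
      (algebraMap Fq[X] (RatFunc Fq) g.2 ^ s₂)⁻¹) with hf
  have hsum : Summable fun a : {g // P g} => f a := by
    refine summable_of_forall_finite hT fun C =>
      (Finset.finite_toSet ((monicPairs Fq C.natAbs).subtype P)).subset fun a ha => ?_
    rw [Finset.mem_coe, Finset.mem_subtype, mem_monicPairs]
    refine ⟨a.2, ?_⟩
    by_contra! h
    refine ha ((valuation_toKinfty_zeta_term_le a.2.1 a.2.2.1 hs s₂).trans (exp_le_exp.2 ?_))
    omega
  have hlim := hsum.hasSum.comp (tendsto_atTop_finset_of_monotone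
    (f := fun N => (monicPairs Fq N).subtype P) (fun M N hMN a ha => ?_) fun a => ?_)
  · rw [tendsToZero_sub_iff hT]
    refine hlim.congr fun N => ?_
    rw [Function.comp_apply, Finset.sum_subtype_of_mem f fun g hg => (mem_monicPairs.1 hg).1,
      sum_monicPairs, map_sum]
    refine Finset.sum_congr rfl fun d _ => ?_
    rw [map_mul, map_sum, Finset.mul_sum]
    refine Finset.sum_congr rfl fun e _ => ?_
    rw [← map_mul, powerSum, powerSum, Finset.sum_mul_sum, map_sum]
    refine Finset.sum_congr rfl fun a _ => ?_
    rw [map_sum]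
    refine Finset.sum_congr rfl fun b _ => ?_
    rw [aeval_algebraMap_X, aeval_algebraMap_X, inv_pow, inv_pow]
  · rw [Finset.mem_subtype, mem_monicPairs] at ha ⊢
    exact ⟨ha.1, ha.2.trans_le hMN⟩
  · exact ⟨a.1.1.natDegree + 1, by
      rw [Finset.mem_subtype, mem_monicPairs]
      exact ⟨a.2, Nat.lt_succ_self _⟩⟩

lemma valuation_varpi : Valued.v (varpi Fq) = exp (Fintype.card Fq : ℤ) := by
  have h := valuation_tprod_periodFactor (valuation_thetaInfty (Fq := Fq))
    (two_le_of_card_eq (F := Fq) rfl)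
  simp only [periodFactor] at h
  rw [varpi, map_mul, Valuation.map_neg, h, mul_one, map_pow, valuation_thetaInfty, ← exp_nsmul]
  simp

lemma hasExpansion_carlitzL_pow_mul_varpi :
    HasExpansion (toKinfty Fq) Valued.v (thetaInfty Fq) (Fintype.card Fq) (fun N =>
      toKinfty Fq (carlitzL (algebraMap Fq[X] (RatFunc Fq) X) (Fintype.card Fq) N) ^
        (Fintype.card Fq - 1) * varpi Fq) := by
  refine hasExpansion_carlitzL_pow_mul_period rfl valuation_thetaInfty
    (two_le_of_card_eq (F := Fq) rfl) ?_
  simpa using congrArg (toKinfty Fq) (neg_one_pow_card_sub_one (Fq := Fq) (RatFunc Fq))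

/-- A relation between the double zeta values of weight `n` and an element whose multiples by
`ℓ_N ^ n` have an asymptotic expansion is trivial. -/
lemma coeff_eq_zero_of_doubleZeta_relation {n : ℕ} {J : Finset ℕ} (hJ : ∀ j ∈ J, j ≠ 0 ∧ j < n)
    {c : ℕ → RatFunc Fq} {P : RatFunc.CompletionAtInfty Fq}
    (hP : HasExpansion (toKinfty Fq) Valued.v (thetaInfty Fq) (Fintype.card Fq) (fun N =>
      toKinfty Fq (carlitzL (algebraMap Fq[X] (RatFunc Fq) X) (Fintype.card Fq) N) ^ n * P))
    (hrel : ∑ j ∈ J, toKinfty Fq (c j) * doubleZeta Fq (n - j) j + P = 0) :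
    ∀ j ∈ J, ¬ (Fintype.card Fq - 1) ∣ j → c j = 0 := by
  have hT := valuation_thetaInfty (Fq := Fq)
  have hq := two_le_of_card_eq (F := Fq) rfl
  have hα := fun (s : ℕ) (hs : s ≠ 0) =>
    exists_powerSum_polynomial (transcendental_algebraMap_X (Fq := Fq)) rfl hs
  choose! α hα1 hα2 using hα
  have hζ := fun (s : ℕ) (hs : s ≠ 0) =>
    exists_tendsToZero_sub_sum hT (tendsToZero_powerSum (Fq := Fq) hs)
  choose! ζ hζ using hζ
  refine coeff_eq_zero_of_zeta_relation (A := (algebraMap Fq[X] (RatFunc Fq)).range)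
    (S := fun s d => powerSum Fq _ d s) (ζ := ζ) rfl ⟨X, rfl⟩
    exists_mul_mem_range_algebraMap (fun x hx => eq_zero_of_mem_range_of_valuation_lt_one hx) hT hq
    hJ hα1 (fun s hs => isBigO_of_mul_carlitzL_pow rfl hT hq hs (hα1 s hs) (hα2 s hs))
    (powerSum_zero_left _) (fun s hs d => ?_) (fun s hs => ?_) (fun j hj => ?_) hP hrel
  · refine (valuation_toKinfty_powerSum_le (d + 1) hs).trans_lt ?_
    rw [← exp_zero, exp_lt_exp]
    omega
  · simpa only [map_sum] using hζ s hs
  · exact tendsToZero_doubleZeta_sub (by have := hJ j hj; omega) j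

lemma card_sub_one_dvd_of_pow_eq_varpi_pow {x : RatFunc.CompletionAtInfty Fq} {n : ℕ}
    (h : x ^ (Fintype.card Fq - 1) = varpi Fq ^ n) : Fintype.card Fq - 1 ∣ n := by
  have h1 := congrArg (fun y => log (Valued.v y)) h
  simp only [map_pow, valuation_varpi, log_pow, log_exp, nsmul_eq_mul] at h1
  have hq := two_le_of_card_eq (F := Fq) rfl
  rw [← Int.natCast_dvd_natCast]
  refine ⟨log (Valued.v x) - n, ?_⟩
  rw [mul_sub, h1]
  push_cast [show 1 ≤ Fintype.card Fq by omega]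
  ring

end Infinity

/-- For every integer `n ≥ 2`, the set
`{π^n} ∪ {ζ_A(s₁, s₂) : s₁, s₂ ≥ 1, s₁ + s₂ = n, (q-1) ∤ s₂}`, viewed inside `L`,
is linearly independent over `k = 𝔽_q(θ)`.  (Here the double zeta values of weight
`n` are indexed by their second entry `s₂ = j ∈ (0, n)` with `(q-1) ∤ j`, the first
entry being `n - j`.)  This verifies Thakur's parity conjecture in depth two. -/
theorem parity_linear_independence
    (Fq : Type) [Field Fq] [Fintype Fq] [DecidableEq (RatFunc Fq)]
    (L : Type) [Field L] (ι : RatFunc.CompletionAtInfty Fq →+* L) (hι : Function.Injective ι)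
    (π : L) (hπ : π ^ (Fintype.card Fq - 1) = ι (varpi Fq))
    (n : ℕ) (hn : 2 ≤ n)
    (c₀ : RatFunc Fq) (c : ℕ → RatFunc Fq)
    (hrel : ι (toKinfty Fq c₀) * π ^ n +
      ∑ j ∈ (Finset.Ioo 0 n).filter (fun j => ¬ (Fintype.card Fq - 1) ∣ j),
        ι (toKinfty Fq (c j) * doubleZeta Fq (n - j) j) = 0) :
    c₀ = 0 ∧
      ∀ j ∈ (Finset.Ioo 0 n).filter (fun j => ¬ (Fintype.card Fq - 1) ∣ j),
        c j = 0 := by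
  have hT := valuation_thetaInfty (Fq := Fq)
  rw [← map_sum] at hrel
  obtain ⟨P, hP, hPπ⟩ : ∃ P, HasExpansion (toKinfty Fq) Valued.v (thetaInfty Fq)
      (Fintype.card Fq) (fun N => toKinfty Fq
        (carlitzL (algebraMap Fq[X] (RatFunc Fq) X) (Fintype.card Fq) N) ^ n * P) ∧
      ι P = ι (toKinfty Fq c₀) * π ^ n := by
    by_cases hdvd : Fintype.card Fq - 1 ∣ n
    · obtain ⟨m, rfl⟩ := hdvd
      refine ⟨toKinfty Fq c₀ * varpi Fq ^ m, ?_, by rw [map_mul, map_pow, pow_mul, hπ]⟩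
      convert (hasExpansion_carlitzL_pow_mul_varpi.pow hT m).mul_evalSeq hT (C c₀) using 1
      funext N
      simp only [Pi.mul_apply, Pi.pow_apply, evalSeq_C]
      ring
    · refine ⟨0, ?_, ?_⟩
      · convert HasExpansion.evalSeq (φ := toKinfty Fq) (v := Valued.v)
          (T := thetaInfty Fq) 0 using 1
        funext N
        simp
      by_cases hc : c₀ = 0
      · simp [hc]
      refine absurd ?_ hdvd
      have hc' : ι (toKinfty Fq c₀) ≠ 0 := by simpa using hc
      set Z := ∑ j ∈ (Finset.Ioo 0 n).filter (fun j => ¬ (Fintype.card Fq - 1) ∣ j),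
        toKinfty Fq (c j) * doubleZeta Fq (n - j) j
      refine card_sub_one_dvd_of_pow_eq_varpi_pow (x := -Z / toKinfty Fq c₀) (hι ?_)
      have h : ι (-Z / toKinfty Fq c₀) = π ^ n := by
        rw [map_div₀, map_neg, div_eq_iff hc']
        linear_combination -hrel
      rw [map_pow, h, map_pow, ← hπ, ← pow_mul, ← pow_mul, mul_comm]
  have hc : ∀ j ∈ (Finset.Ioo 0 n).filter (fun j => ¬ (Fintype.card Fq - 1) ∣ j), c j = 0 := by
    intro j hj
    refine coeff_eq_zero_of_doubleZeta_relation (fun i hi => ?_) hP (hι ?_) j hj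
      (Finset.mem_filter.1 hj).2
    · have := Finset.mem_Ioo.1 (Finset.mem_filter.1 hi).1
      omega
    · rw [map_add, hPπ, add_comm, hrel, map_zero]
  refine ⟨?_, hc⟩
  rw [Finset.sum_eq_zero fun j hj => by rw [hc j hj, map_zero, zero_mul], map_zero,
    add_zero] at hrel
  have hϖ : varpi Fq ≠ 0 := fun h => by
    have := valuation_varpi (Fq := Fq)
    rw [h, map_zero] at this
    exact WithZero.exp_ne_zero this.symm
  have hπ0 : π ≠ 0 := by
    rintro rfl
    have hq := two_le_of_card_eq (F := Fq) rfl
    rw [zero_pow (by omega)] at hπ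
    exact hϖ (hι (by rw [← hπ, map_zero]))
  simpa [hπ0] using hrel
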